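/- arXiv:2408.12543 — 5 statements merged into one kernel-verified Lean document; each statement's English description precedes it below -/
import Mathlib

section
/- Fix integers n > k ≥ 1 and K = k(n−k+1). Let D be a (K,k) Dyck path with big tuple b = (b_1,…,b_k) and complementary small tuple s. For an allowable content α of length n−k, let P(D,b,α) denote the set of labelings of the big boxes of (D,b) by labels in {1,…,n−k}, strictly increasing up each column, in which the label i occurs exactly k − α_i times for each i (so P(D,b,α) is empty if some α_i > k). Then, in the polynomial ring ℤ[q]: Σ_{α allowable} (−1)^{z(α)} Σ_{P ∈ P(D,b,α)} q^{tdinv_big(P)} = q^{maxtdinv(D) − pathdinv(D) − d(s,b)} if b is admissible, and the left-hand side equals 0 if b is not admissible; here z(α) is the number of zero entries of α. -/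
open scoped Classical
open Finset

noncomputable section

/-- A `(K, k)` Dyck path, encoded by cumulative column heights: `H i` is the number
of north steps taken before the `i`-th east step (equivalently, the number of north
steps in columns `0, …, i-1`), normalized so that `H i = K` for `i ≥ k`.  The path
runs from `(0,0)` to `(k, K)` and stays weakly above the line segment from `(0,0)`
to `(k, K)`. -/
def IsDyck (K k : ℕ) (H : ℕ → ℕ) : Prop :=
  H 0 = 0 ∧ Monotone H ∧ (∀ i, k ≤ i → H i = K) ∧ ∀ i, i ≤ k → K * i ≤ k * H i

/-- The labeled boxes of the path `H`: the boxes immediately to the right of its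
north steps (indexed by lower-left corners `(column, height)`). -/
def boxesD (K k : ℕ) (H : ℕ → ℕ) : Finset (ℕ × ℕ) :=
  (range k ×ˢ range K).filter fun B => H B.1 ≤ B.2 ∧ B.2 < H (B.1 + 1)

/-- The diagonal index of a box, for diagonals of slope `c = K / k`. -/
def diagIdx (c : ℕ) (B : ℕ × ℕ) : ℤ := (B.2 : ℤ) - (c : ℤ) * (B.1 : ℤ)

/-- `(A, B)` is an attacking (ordered) pair of boxes: `A` and `B` on the same
diagonal with `A` strictly to the left, or `A` one diagonal below `B` and strictly
to its right. -/
def Attack (c : ℕ) (A B : ℕ × ℕ) : Prop :=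
  (diagIdx c A = diagIdx c B ∧ A.1 < B.1) ∨
    (diagIdx c A = diagIdx c B - 1 ∧ B.1 < A.1)

/-- The attacking pairs among boxes of `S`. -/
def attackPairsOn (c : ℕ) (S : Finset (ℕ × ℕ)) : Finset ((ℕ × ℕ) × (ℕ × ℕ)) :=
  (S ×ˢ S).filter fun p => Attack c p.1 p.2

/-- The number of attacking pairs among boxes of `S` whose labels increase
(`tdinv`). -/
def tdinvOn (c : ℕ) (S : Finset (ℕ × ℕ)) (L : ℕ × ℕ → ℕ) : ℕ :=
  ((S ×ˢ S).filter fun p => Attack c p.1 p.2 ∧ L p.1 < L p.2).card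

/-- A word parking function of shape `H`: positive labels on the labeled boxes,
strictly increasing up each maximal run of north steps (= each column). -/
def IsWordPF (K k : ℕ) (H : ℕ → ℕ) (L : ℕ × ℕ → ℕ) : Prop :=
  (∀ B ∈ boxesD K k H, 1 ≤ L B) ∧
  ∀ i y, i < k → H i ≤ y → y + 1 < H (i + 1) → L (i, y) < L (i, y + 1)

/-- `maxtdinv` of the path `H`: the maximum of `tdinv` over all word parking
functions of shape `H`. -/
def maxtdinvD (c K k : ℕ) (H : ℕ → ℕ) : ℕ :=
  sSup {m : ℕ | ∃ L : ℕ × ℕ → ℕ, IsWordPF K k H L ∧ tdinvOn c (boxesD K k H) L = m}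

/-- The arm of a box strictly above the path: the number of boxes above the path
strictly to its right in its row. -/
def armD (k : ℕ) (H : ℕ → ℕ) (B : ℕ × ℕ) : ℕ :=
  ((Finset.Ioo B.1 k).filter fun j => H (j + 1) ≤ B.2).card

/-- The leg of a box strictly above the path: the number of boxes above the path
strictly below it in its column. -/
def legD (H : ℕ → ℕ) (B : ℕ × ℕ) : ℕ := B.2 - H (B.1 + 1)

/-- `pathdinv` of the path: the number of boxes `B` strictly above the path with
`arm B / (leg B + 1) ≤ k / K < (arm B + 1) / leg B`. -/
def pathdinvD (K k : ℕ) (H : ℕ → ℕ) : ℕ :=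
  ((range k ×ˢ range K).filter fun B =>
    H (B.1 + 1) ≤ B.2 ∧ armD k H B * K ≤ k * (legD H B + 1) ∧
      k * legD H B < (armD k H B + 1) * K).card

/-- A big tuple `b` for the path `H`: `b i` is at most the number of north steps in
column `i`, `∑ b i = K - n`, normalized by `b i = 0` for `i ≥ k`. -/
def IsBigTuple (n k : ℕ) (H b : ℕ → ℕ) : Prop :=
  (∀ i, i < k → b i ≤ H (i + 1) - H i) ∧
  (∑ i ∈ range k, b i = k * (n - k + 1) - n) ∧ ∀ i, k ≤ i → b i = 0

/-- Admissibility: `b i ≤ n - k` for all `i`. -/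
def AdmissibleB (n k : ℕ) (b : ℕ → ℕ) : Prop := ∀ i, i < k → b i ≤ n - k

/-- The big boxes of `(H, b)`: the top `b i` labeled boxes of column `i`. -/
def bigBoxes (K k : ℕ) (H b : ℕ → ℕ) : Finset (ℕ × ℕ) :=
  (range k ×ˢ range K).filter fun B =>
    H B.1 ≤ B.2 ∧ H (B.1 + 1) - b B.1 ≤ B.2 ∧ B.2 < H (B.1 + 1)

/-- The small boxes of `(H, b)`: the remaining labeled boxes. -/
def smallBoxes (K k : ℕ) (H b : ℕ → ℕ) : Finset (ℕ × ℕ) :=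
  (range k ×ˢ range K).filter fun B =>
    H B.1 ≤ B.2 ∧ B.2 < H (B.1 + 1) - b B.1

/-- An *allowable content* of length `m`. -/
def AllowableContent (m : ℕ) (α : Fin m → ℕ) : Prop :=
  (∀ i, α i ≤ m) ∧
  (∀ h0 : 0 < m, 0 < α ⟨0, h0⟩) ∧
  ∀ i : Fin m, 0 < α i →
    (i : ℕ) + α i ≤ m ∧
    (∀ j : Fin m, (i : ℕ) < (j : ℕ) → (j : ℕ) < (i : ℕ) + α i → α j = 0) ∧
    ∀ hj : (i : ℕ) + α i < m, 0 < α ⟨(i : ℕ) + α i, hj⟩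

/-- The big boxes of `(D, b)` as a type. -/
abbrev BigBox (n k : ℕ) (H b : ℕ → ℕ) :=
  {x : ℕ × ℕ // x ∈ bigBoxes (k * (n - k + 1)) k H b}

/-- A labeling of the big boxes by labels in `{1, …, n-k}` (encoded by
`Fin (n - k)`, with `ℓ` standing for the label `ℓ + 1`), strictly increasing up
each column. -/
def ColStrict (n k : ℕ) (H b : ℕ → ℕ) (f : BigBox n k H b → Fin (n - k)) : Prop :=
  ∀ A B : BigBox n k H b, A.1.1 = B.1.1 → A.1.2 < B.1.2 → f A < f B

/-- The labeling `f` has content complementary to `α`: the label `ℓ + 1` occurs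
exactly `k - α ℓ` times (as integers, so this is impossible when `α ℓ > k`). -/
def HasContent (n k : ℕ) (H b : ℕ → ℕ) (α : Fin (n - k) → Fin (n - k + 1))
    (f : BigBox n k H b → Fin (n - k)) : Prop :=
  ∀ ℓ : Fin (n - k),
    (((Finset.univ : Finset (BigBox n k H b)).filter fun B => f B = ℓ).card : ℤ) =
      (k : ℤ) - ((α ℓ : ℕ) : ℤ)

/-- `tdinv_big` of a labeling of the big boxes: the number of attacking pairs of
big boxes whose labels increase. -/
def tdinvBigF (n k : ℕ) (H b : ℕ → ℕ) (f : BigBox n k H b → Fin (n - k)) : ℕ :=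
  ((Finset.univ ×ˢ Finset.univ : Finset (BigBox n k H b × BigBox n k H b)).filter
    fun p => Attack (n - k + 1) p.1.1 p.2.1 ∧ f p.1 < f p.2).card

/-- Content-allowability of `τ` says that each occurring label counts the smaller labels. -/
theorem allowableContent_card_fiber_iff {R : Type*} [Fintype R] {m : ℕ}
    (hR : Fintype.card R = m) (τ : R → Fin m) :
    AllowableContent m (fun ℓ => #{u | τ u = ℓ}) ↔ ∀ u, #{v | τ v < τ u} = (τ u : ℕ) := by
  unfold AllowableContent
  beta_reduce
  set s : ℕ → ℕ := fun j => #{v | (τ v : ℕ) < j} with hs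
  have hadd : ∀ (ℓ : Fin m) (j : ℕ), (ℓ : ℕ) < j → (∀ v, ℓ < τ v → j ≤ (τ v : ℕ)) →
      s j = s ℓ + #{u | τ u = ℓ} := by
    intro ℓ j hj h
    rw [hs]
    dsimp only
    rw [← card_union_of_disjoint]
    · congr 1
      ext v
      simp only [mem_filter, mem_univ, true_and, mem_union]
      have := h v
      rw [Fin.lt_def] at this
      rw [Fin.ext_iff]
      omega
    · rw [disjoint_filter]
      intro v _ hv h'
      rw [h'] at hv
      omega
  have hpos : ∀ u, 0 < #{v | τ v = τ u} := fun u => card_pos.2 ⟨u, by simp⟩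
  have hex : ∀ ℓ, 0 < #{v | τ v = ℓ} → ∃ u, τ u = ℓ := by
    intro ℓ h
    obtain ⟨u, hu⟩ := card_pos.1 h
    exact ⟨u, by simpa using hu⟩
  have hs_le : ∀ j, s j ≤ m := fun j => (card_le_univ _).trans_eq hR
  constructor
  · rintro ⟨-, h0, hα⟩ u
    suffices ∀ j, ∀ u, (τ u : ℕ) = j → s j = j from this _ u rfl
    intro j
    induction j using Nat.strong_induction_on with
    | _ j ih =>
    intro u hu
    rcases Nat.eq_zero_or_pos j with rfl | hj
    · simp [hs]
    have hm : 0 < m := by have := (τ u).2; omega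
    obtain ⟨x, hx⟩ := hex _ (h0 hm)
    have hne : ({v | (τ v : ℕ) < j} : Finset R).Nonempty := ⟨x, by simp [hx, hj]⟩
    obtain ⟨w, hw, hmax⟩ := exists_max_image _ τ hne
    simp only [mem_filter, mem_univ, true_and] at hw hmax
    obtain ⟨h1, h2, h3⟩ := hα (τ w) (hpos w)
    have hle : (τ w : ℕ) + #{v | τ v = τ w} ≤ j := by
      by_contra hlt
      have h2 := h2 (τ u) (by omega) (by omega)
      have := hpos u
      omega
    have hge : j ≤ (τ w : ℕ) + #{v | τ v = τ w} := by
      by_contra hlt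
      obtain ⟨y, hy⟩ := hex _ (h3 (by have := (τ u).2; omega))
      have hy' : (τ y : ℕ) = (τ w : ℕ) + #{v | τ v = τ w} := by rw [hy]
      have := hmax y (by omega)
      rw [Fin.le_def] at this
      have := hpos w
      omega
    rw [hadd (τ w) j hw, ih _ hw w rfl]
    · omega
    · intro v hv
      by_contra hlt
      have := hmax v (by omega)
      exact absurd hv (not_lt.2 this)
  · intro h
    have h' : ∀ u, s (τ u) = τ u := h
    have hnext : ∀ u j, j < m → (τ u : ℕ) + #{v | τ v = τ u} = j → ∃ v, (τ v : ℕ) = j := by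
      intro u j hj hu
      have hne : ({v | τ u < τ v} : Finset R).Nonempty := by
        by_contra hne
        rw [not_nonempty_iff_eq_empty, filter_eq_empty_iff] at hne
        have h1 := hadd (τ u) m (τ u).2 (fun v hv => absurd hv (hne (mem_univ v)))
        have : s m = m := by
          rw [← hR, hs, ← card_univ]
          dsimp only
          congr 1
          ext v
          simp [hR]
        rw [h' u] at h1
        omega
      obtain ⟨w, hw, hmin⟩ := exists_min_image _ τ hne
      simp only [mem_filter, mem_univ, true_and] at hw hmin
      have := hadd (τ u) (τ w) hw (fun v hv => hmin v hv)
      rw [h' u, h' w] at this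
      exact ⟨w, by omega⟩
    refine ⟨fun i => ?_, fun h0 => ?_, fun i hi => ?_⟩
    · exact (card_le_univ _).trans_eq hR
    · have : Nonempty R := by rw [← Fintype.card_pos_iff]; omega
      obtain ⟨w, -, hmin⟩ := exists_min_image (univ : Finset R) τ univ_nonempty
      have : s (τ w) = 0 := by
        rw [hs, card_eq_zero, filter_eq_empty_iff]
        intro v hv
        have := hmin v (mem_univ v)
        rw [Fin.le_def] at this
        omega
      have h0' : τ w = ⟨0, h0⟩ := by
        rw [Fin.ext_iff, ← h' w, this]
      rw [← h0']
      exact hpos w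
    · obtain ⟨u, rfl⟩ := hex i hi
      have h1 := hadd (τ u) (τ u + 1) (by omega) (fun v hv => hv)
      rw [h' u] at h1
      refine ⟨by have := hs_le (τ u + 1); omega, fun j hj hlt => ?_, fun hj => ?_⟩
      · by_contra hne
        obtain ⟨v, rfl⟩ := hex j (Nat.pos_of_ne_zero hne)
        have h2 : s (τ u + 1) ≤ s (τ v) := card_le_card fun x hx => by
          simp only [mem_filter, mem_univ, true_and] at hx ⊢
          omega
        rw [h' v] at h2
        omega
      · obtain ⟨v, hv⟩ := hnext u _ hj rfl
        have : τ v = ⟨_, hj⟩ := Fin.ext hv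
        rw [← this]
        exact hpos v

/-- The rank of `u` in the order that sorts first by `τ`, then by the order of `R`. -/
def stdRank {R : Type*} [Fintype R] [LinearOrder R] {m : ℕ} (τ : R → Fin m) (u : R) : ℕ :=
  #{v | τ v < τ u ∨ τ v = τ u ∧ v < u}

theorem stdRank_lt_iff {R : Type*} [Fintype R] [LinearOrder R] {m : ℕ} (τ : R → Fin m)
    (u v : R) : stdRank τ v < stdRank τ u ↔ τ v < τ u ∨ τ v = τ u ∧ v < u := by
  have key : ∀ u v : R, (τ v < τ u ∨ τ v = τ u ∧ v < u) → stdRank τ v < stdRank τ u := by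
    intro u v h
    refine card_lt_card ⟨fun x hx => ?_, fun hsub => ?_⟩
    · simp only [mem_filter, mem_univ, true_and] at hx ⊢
      grind
    · have := @hsub v (by simpa using h)
      simp at this
  refine ⟨fun h => ?_, key u v⟩
  by_contra hn
  have : u = v ∨ (τ u < τ v ∨ τ u = τ v ∧ u < v) := by grind
  rcases this with rfl | h'
  · exact lt_irrefl _ h
  · exact lt_asymm h (key v u h')

theorem stdRank_lt_card {R : Type*} [Fintype R] [LinearOrder R] {m : ℕ} (τ : R → Fin m)
    (u : R) : stdRank τ u < Fintype.card R :=
  card_lt_univ_of_notMem (x := u) (by simp)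

/-- The standardization of `τ`, as a bijection onto `Fin m`. -/
def stdEquiv {R : Type*} [Fintype R] [LinearOrder R] {m : ℕ} (hR : Fintype.card R = m)
    (τ : R → Fin m) : R ≃ Fin m :=
  Equiv.ofBijective (fun u => ⟨stdRank τ u, (stdRank_lt_card τ u).trans_eq hR⟩) <| by
    rw [Fintype.bijective_iff_injective_and_card]
    refine ⟨fun u v h => ?_, by simp [hR]⟩
    rw [Fin.mk.injEq] at h
    by_contra hne
    have h1 := stdRank_lt_iff τ u v
    have h2 := stdRank_lt_iff τ v u
    grind

theorem val_stdEquiv {R : Type*} [Fintype R] [LinearOrder R] {m : ℕ} (hR : Fintype.card R = m)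
    (τ : R → Fin m) (u : R) : (stdEquiv hR τ u : ℕ) = stdRank τ u := rfl

/-- The ascents of the word inverse to `σ`. -/
def ascentSet {R : Type*} [LinearOrder R] {m : ℕ} (σ : R ≃ Fin m) : Finset (Fin m) :=
  {j | ∃ i : Fin m, (i : ℕ) + 1 = j ∧ σ.symm i < σ.symm j}

/-- The largest index at most `j` outside `N` (or `0` if there is none). -/
def blockStart {m : ℕ} (N : Finset (Fin m)) (j : Fin m) : Fin m :=
  ⟨Nat.findGreatest (fun i => ∃ h : i < m, (⟨i, h⟩ : Fin m) ∉ N) j,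
    (Nat.findGreatest_le _).trans_lt j.2⟩

theorem blockStart_le {m : ℕ} (N : Finset (Fin m)) (j : Fin m) : blockStart N j ≤ j :=
  Nat.findGreatest_le (P := fun i => ∃ h : i < m, (⟨i, h⟩ : Fin m) ∉ N) _

theorem le_blockStart {m : ℕ} {N : Finset (Fin m)} {i j : Fin m} (hij : i ≤ j) (hi : i ∉ N) :
    i ≤ blockStart N j :=
  Nat.le_findGreatest (P := fun i => ∃ h : i < m, (⟨i, h⟩ : Fin m) ∉ N) hij ⟨i.2, hi⟩

theorem blockStart_mono {m : ℕ} (N : Finset (Fin m)) : Monotone (blockStart N) :=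
  fun _ _ h => Nat.findGreatest_mono_right _ h

theorem blockStart_notMem {m : ℕ} {N : Finset (Fin m)}
    (hN : ∀ j ∈ N, (j : ℕ) ≠ 0) (j : Fin m) : blockStart N j ∉ N := by
  have h0 : 0 < m := lt_of_le_of_lt (Nat.zero_le _) j.2
  have := Nat.findGreatest_spec (P := fun i => ∃ h : i < m, (⟨i, h⟩ : Fin m) ∉ N)
    (Nat.zero_le (j : ℕ)) ⟨h0, fun h => hN _ h rfl⟩
  exact this.2

theorem blockStart_of_notMem {m : ℕ} {N : Finset (Fin m)} {j : Fin m} (hj : j ∉ N) :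
    blockStart N j = j :=
  le_antisymm (blockStart_le N j) (le_blockStart le_rfl hj)

theorem symm_lt_symm_of_ascents {R : Type*} [LinearOrder R] {m : ℕ} (σ : R ≃ Fin m)
    (a b : Fin m) (hab : a < b) (h : ∀ j, a < j → j ≤ b → j ∈ ascentSet σ) :
    σ.symm a < σ.symm b := by
  obtain ⟨b, hb⟩ := b
  induction b with
  | zero => exact absurd hab (Nat.not_lt_zero _)
  | succ b ih =>
    have hb' : b < m := by omega
    have h1 : σ.symm ⟨b, hb'⟩ < σ.symm ⟨b + 1, hb⟩ := by
      have := h ⟨b + 1, hb⟩ hab le_rfl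
      simp only [ascentSet, mem_filter, mem_univ, true_and] at this
      obtain ⟨i, hi, hlt⟩ := this
      have : i = ⟨b, hb'⟩ := Fin.ext (by simpa using hi)
      rwa [this] at hlt
    rcases (show (a : ℕ) = b ∨ (a : ℕ) < b by rw [Fin.lt_def] at hab; simp at hab; omega)
      with he | hlt
    · have : a = ⟨b, hb'⟩ := Fin.ext he
      rwa [this]
    · refine (ih hb' hlt fun j hj hjb => h j hj (hjb.trans ?_)).trans h1
      rw [Fin.le_def]; simp

/-- A map recovered from its standardization. -/
theorem stdRank_blockStart {R : Type*} [Fintype R] [LinearOrder R] {m : ℕ} (σ : R ≃ Fin m)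
    {N : Finset (Fin m)} (hN : N ⊆ ascentSet σ) (u v : R) :
    (blockStart N (σ v) < blockStart N (σ u) ∨
      blockStart N (σ v) = blockStart N (σ u) ∧ v < u) ↔ σ v < σ u := by
  have key : ∀ u v, σ v < σ u → (blockStart N (σ v) < blockStart N (σ u) ∨
      blockStart N (σ v) = blockStart N (σ u) ∧ v < u) := by
    intro u v h
    rcases (blockStart_mono N h.le).lt_or_eq with hlt | heq
    · exact Or.inl hlt
    · refine Or.inr ⟨heq, ?_⟩
      have := symm_lt_symm_of_ascents σ _ _ h fun j hj hju => hN ?_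
      · simpa using this
      · by_contra hjN
        have := le_blockStart hju hjN
        rw [← heq] at this
        exact absurd hj (not_lt.2 (this.trans (blockStart_le N _)))
  refine ⟨fun h => ?_, key u v⟩
  by_contra hn
  rcases (not_lt.1 hn).lt_or_eq with hlt | heq
  · have := key v u hlt
    grind
  · have := σ.injective heq
    grind

theorem pos_of_mem_ascentSet {R : Type*} [LinearOrder R] {m : ℕ} {σ : R ≃ Fin m} {j : Fin m}
    (hj : j ∈ ascentSet σ) : (j : ℕ) ≠ 0 := by
  simp only [ascentSet, mem_filter, mem_univ, true_and] at hj
  obtain ⟨i, hi, -⟩ := hj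
  omega

theorem stdEquiv_blockStart {R : Type*} [Fintype R] [LinearOrder R] {m : ℕ}
    (hR : Fintype.card R = m) (σ : R ≃ Fin m) {N : Finset (Fin m)} (hN : N ⊆ ascentSet σ) :
    stdEquiv hR (fun u => blockStart N (σ u)) = σ := by
  ext u
  rw [val_stdEquiv, stdRank]
  simp only [stdRank_blockStart σ hN]
  rw [card_equiv (t := Iio (σ u)) σ (by simp), Fin.card_Iio]

theorem card_blockStart_lt {R : Type*} [Fintype R] [LinearOrder R] {m : ℕ} (σ : R ≃ Fin m)
    {N : Finset (Fin m)} (hN : N ⊆ ascentSet σ) (u : R) :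
    #{v | blockStart N (σ v) < blockStart N (σ u)} = (blockStart N (σ u) : ℕ) := by
  rw [card_equiv (t := Iio (blockStart N (σ u))) σ, Fin.card_Iio]
  intro v
  simp only [mem_filter, mem_univ, true_and, mem_Iio]
  constructor
  · intro h
    by_contra hn
    have := le_blockStart (not_lt.1 hn) (blockStart_notMem (fun j hj =>
      pos_of_mem_ascentSet (hN hj)) (σ u))
    exact absurd h (not_lt.2 this)
  · exact (blockStart_le N _).trans_lt

theorem missing_blockStart {R : Type*} [Fintype R] [LinearOrder R] {m : ℕ} (σ : R ≃ Fin m)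
    {N : Finset (Fin m)} (hN : N ⊆ ascentSet σ) :
    ({ℓ | ∀ u, blockStart N (σ u) ≠ ℓ} : Finset (Fin m)) = N := by
  ext ℓ
  simp only [mem_filter, mem_univ, true_and]
  constructor
  · intro h
    by_contra hℓ
    exact h (σ.symm ℓ) (by simp [blockStart_of_notMem hℓ])
  · rintro hℓ u rfl
    exact blockStart_notMem (fun j hj => pos_of_mem_ascentSet (hN hj)) _ hℓ

theorem le_stdEquiv {R : Type*} [Fintype R] [LinearOrder R] {m : ℕ} (hR : Fintype.card R = m)
    {τ : R → Fin m} (hτ : ∀ u, #{v | τ v < τ u} = (τ u : ℕ)) (u : R) :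
    τ u ≤ stdEquiv hR τ u := by
  rw [Fin.le_def, val_stdEquiv, ← hτ u]
  exact card_le_card fun v hv => by
    simp only [mem_filter, mem_univ, true_and] at hv ⊢
    exact Or.inl hv

theorem stdEquiv_lt_of_lt {R : Type*} [Fintype R] [LinearOrder R] {m : ℕ}
    (hR : Fintype.card R = m) {τ : R → Fin m} (hτ : ∀ u, #{v | τ v < τ u} = (τ u : ℕ))
    {u v : R} (h : τ u < τ v) : stdEquiv hR τ u < τ v := by
  rw [Fin.lt_def, val_stdEquiv, ← hτ v]
  refine card_lt_card ⟨fun x hx => ?_, fun hsub => ?_⟩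
  · simp only [mem_filter, mem_univ, true_and] at hx ⊢
    grind
  · have := @hsub u (by simpa using h)
    simp at this

theorem missing_subset_ascentSet {R : Type*} [Fintype R] [LinearOrder R] {m : ℕ}
    (hR : Fintype.card R = m) {τ : R → Fin m} (hτ : ∀ u, #{v | τ v < τ u} = (τ u : ℕ)) :
    ({ℓ | ∀ u, τ u ≠ ℓ} : Finset (Fin m)) ⊆ ascentSet (stdEquiv hR τ) := by
  intro j hj
  simp only [mem_filter, mem_univ, true_and] at hj
  set σ := stdEquiv hR τ with hσ
  have h0 : (j : ℕ) ≠ 0 := by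
    intro h0
    have h1 := le_stdEquiv hR hτ (σ.symm j)
    rw [← hσ, Equiv.apply_symm_apply] at h1
    exact hj _ (le_antisymm h1 (by rw [Fin.le_def]; omega))
  simp only [ascentSet, mem_filter, mem_univ, true_and]
  refine ⟨⟨j - 1, by omega⟩, by simp; omega, ?_⟩
  set u := σ.symm ⟨j - 1, by omega⟩ with hu
  set v := σ.symm j with hv
  have hσu : (σ u : ℕ) = j - 1 := by simp [hu]
  have hσv : σ v = j := by simp [hv]
  have hlt : stdRank τ u < stdRank τ v := by
    rw [← val_stdEquiv hR, ← val_stdEquiv hR, ← hσ, hσu, hσv]; omega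
  rcases (stdRank_lt_iff τ v u).1 hlt with h | h
  · have h1 := stdEquiv_lt_of_lt hR hτ h
    have h2 := le_stdEquiv hR hτ v
    rw [← hσ] at h1 h2
    rw [hσv] at h2
    exact absurd (le_antisymm h2 (by rw [Fin.lt_def] at h1; rw [Fin.le_def]; omega)) (hj v)
  · exact h.2

theorem blockStart_missing {R : Type*} [Fintype R] [LinearOrder R] {m : ℕ}
    (hR : Fintype.card R = m) {τ : R → Fin m} (hτ : ∀ u, #{v | τ v < τ u} = (τ u : ℕ)) (u : R) :
    blockStart ({ℓ | ∀ u, τ u ≠ ℓ} : Finset (Fin m)) (stdEquiv hR τ u) = τ u := by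
  apply le_antisymm
  · have h := blockStart_notMem (fun j hj =>
      pos_of_mem_ascentSet (missing_subset_ascentSet hR hτ hj)) (stdEquiv hR τ u)
    simp only [mem_filter, mem_univ, true_and, not_forall, not_not] at h
    obtain ⟨x, hx⟩ := h
    by_contra hlt
    rw [← hx, not_le] at hlt
    have h1 := stdEquiv_lt_of_lt hR hτ hlt
    rw [hx] at h1
    exact absurd h1 (not_lt.2 (blockStart_le _ _))
  · exact le_blockStart (le_stdEquiv hR hτ u) (by simp)

theorem stdEquiv_lt_iff {R : Type*} [Fintype R] [LinearOrder R] {m : ℕ}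
    (hR : Fintype.card R = m) (τ : R → Fin m) {u v : R} (huv : u < v) :
    stdEquiv hR τ v < stdEquiv hR τ u ↔ τ v < τ u := by
  rw [Fin.lt_def, val_stdEquiv, val_stdEquiv, stdRank_lt_iff]
  have := huv.not_gt
  tauto

theorem symm_strictAnti_of_ascentSet_eq_empty {R : Type*} [LinearOrder R] {m : ℕ}
    {σ : R ≃ Fin m} (h : ascentSet σ = ∅) : StrictAnti σ.symm := by
  cases m with
  | zero => exact fun a => a.elim0
  | succ m =>
    rw [Fin.strictAnti_iff_succ_lt]
    intro i
    by_contra hn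
    have : i.succ ∈ ascentSet σ := by
      simp only [ascentSet, mem_filter, mem_univ, true_and]
      refine ⟨i.castSucc, by simp, (not_lt.1 hn).lt_of_ne fun he => ?_⟩
      have := congrArg Fin.val (σ.symm.injective he)
      simp at this
    simp [h] at this

/-- The order-reversing bijection is the only one without ascents. -/
theorem exists_ascentSet_eq_empty_iff {R : Type*} [Fintype R] [LinearOrder R] {m : ℕ}
    (hR : Fintype.card R = m) :
    ∃ ρ : R ≃ Fin m, (∀ u v, u < v → ρ v < ρ u) ∧ ∀ σ : R ≃ Fin m, ascentSet σ = ∅ ↔ σ = ρ := by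
  let e := Fintype.orderIsoFinOfCardEq R hR
  let ρ : R ≃ Fin m := e.toEquiv.symm.trans Fin.revPerm
  have hρ : ∀ u v, u < v → ρ v < ρ u := fun u v h => by
    simp only [ρ, Equiv.trans_apply, Fin.revPerm_apply, Fin.rev_lt_rev]
    exact e.symm.lt_iff_lt.2 h
  refine ⟨ρ, hρ, fun σ => ⟨fun h => ?_, ?_⟩⟩
  · have h1 : StrictMono (fun i => σ.symm (Fin.rev i)) :=
      (symm_strictAnti_of_ascentSet_eq_empty h).comp Fin.rev_strictAnti
    have h2 : (fun i => σ.symm (Fin.rev i)) = e := by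
      refine StrictMono.range_inj h1 e.strictMono |>.1 ?_
      rw [e.surjective.range_eq]
      exact (σ.symm.surjective.comp Fin.rev_surjective).range_eq
    ext u
    have h3 := congrFun h2 (Fin.rev (σ u))
    simp only [Fin.rev_rev, Equiv.symm_apply_apply] at h3
    have : ρ u = σ u := by
      simp only [ρ, Equiv.trans_apply, Fin.revPerm_apply]
      conv_lhs => rw [h3]
      simp
    rw [this]
  · rintro rfl
    rw [ascentSet, filter_eq_empty_iff]
    rintro j - ⟨i, hi, hlt⟩
    have := hρ _ _ hlt
    simp only [Equiv.apply_symm_apply, Fin.lt_def] at this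
    omega

/-- Signed summation over packed labelings collapses to the order-reversing one. -/
theorem sum_signed_packed {R : Type*} [Fintype R] [LinearOrder R] {m : ℕ}
    (hR : Fintype.card R = m) (E A : R → R → Prop) (hE : ∀ u v, E u v → u < v)
    (hA : ∀ u v, A u v → u < v) :
    ∑ τ ∈ (univ : Finset (R → Fin m)).filter (fun τ =>
        (∀ u, #{v | τ v < τ u} = (τ u : ℕ)) ∧ ∀ u v, E u v → τ v < τ u),
      (-1 : Polynomial ℤ) ^ #{ℓ | ∀ u, τ u ≠ ℓ} *
        Polynomial.X ^ #{p : R × R | A p.1 p.2 ∧ τ p.2 < τ p.1} =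
      Polynomial.X ^ #{p : R × R | A p.1 p.2} := by
  set inv : (R ≃ Fin m) → ℕ := fun σ => #{p : R × R | A p.1 p.2 ∧ σ p.2 < σ p.1} with hinv
  set G : Finset (R ≃ Fin m) := univ.filter fun σ => ∀ u v, E u v → σ v < σ u with hG
  calc
    _ = ∑ x ∈ G.sigma fun σ => (ascentSet σ).powerset,
          (-1 : Polynomial ℤ) ^ #x.2 * Polynomial.X ^ inv x.1 := by
      refine sum_bij' (fun τ _ => ⟨stdEquiv hR τ, univ.filter fun ℓ => ∀ u, τ u ≠ ℓ⟩)
        (fun x _ u => blockStart x.2 (x.1 u)) ?_ ?_ ?_ ?_ ?_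
      · intro τ hτ
        simp only [mem_filter, mem_univ, true_and] at hτ
        simp only [mem_sigma, hG, mem_filter, mem_univ, true_and, mem_powerset]
        exact ⟨fun u v h => (stdEquiv_lt_iff hR τ (hE u v h)).2 (hτ.2 u v h),
          missing_subset_ascentSet hR hτ.1⟩
      · rintro ⟨σ, N⟩ hx
        simp only [mem_sigma, hG, mem_filter, mem_univ, true_and, mem_powerset] at hx
        simp only [mem_filter, mem_univ, true_and]
        refine ⟨card_blockStart_lt σ hx.2, fun u v h => ?_⟩
        have h1 := (stdRank_blockStart σ hx.2 u v).2 (hx.1 u v h)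
        have := (hE u v h).not_gt
        tauto
      · intro τ hτ
        simp only [mem_filter, mem_univ, true_and] at hτ
        funext u
        exact blockStart_missing hR hτ.1 u
      · rintro ⟨σ, N⟩ hx
        simp only [mem_sigma, mem_powerset] at hx
        simp only [stdEquiv_blockStart hR σ hx.2, missing_blockStart σ hx.2]
      · intro τ hτ
        simp only [hinv]
        congr 3
        ext p
        simp only [mem_filter, mem_univ, true_and]
        exact and_congr_right fun h => (stdEquiv_lt_iff hR τ (hA _ _ h)).symm
    _ = ∑ σ ∈ G, if ascentSet σ = ∅ then Polynomial.X ^ inv σ else 0 := by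
      rw [sum_sigma]
      refine sum_congr rfl fun σ _ => ?_
      dsimp only
      rw [← sum_mul]
      have h1 := sum_powerset_neg_one_pow_card (x := ascentSet σ)
      have h2 := congrArg (Int.castRingHom (Polynomial ℤ)) h1
      rw [map_sum] at h2
      simp only [map_pow, map_neg, map_one] at h2
      rw [h2]
      split_ifs <;> simp
    _ = _ := by
      obtain ⟨ρ, hρ, hu⟩ := exists_ascentSet_eq_empty_iff hR
      simp only [hu]
      rw [sum_ite_eq' G ρ, if_pos]
      · simp only [hinv]
        congr 2
        ext p
        simp only [mem_filter, mem_univ, true_and]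
        exact ⟨fun h => h.1, fun h => ⟨h, hρ _ _ (hA _ _ h)⟩⟩
      · simp only [hG, mem_filter, mem_univ, true_and]
        exact fun u v h => hρ u v (hE u v h)

/-- Labels strictly increase with the height `ht` within each column of `X`. -/
def ColInc {X : Type*} (col : X → ℕ) (ht : X → ℤ) {m : ℕ} (φ : X → Fin m) : Prop :=
  ∀ x y, col x = col y → ht x < ht y → φ x < φ y

/-- The pairs (column, label) that occur in a labeling. -/
def labelPairs {X : Type*} [Fintype X] (col : X → ℕ) {m : ℕ} (φ : X → Fin m) :
    Finset (ℕ × Fin m) :=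
  univ.image fun x => (col x, φ x)

theorem mem_labelPairs {X : Type*} [Fintype X] {col : X → ℕ} {m : ℕ} {φ : X → Fin m}
    {p : ℕ × Fin m} : p ∈ labelPairs col φ ↔ ∃ x, col x = p.1 ∧ φ x = p.2 := by
  simp [labelPairs, Prod.ext_iff]

section Columns

variable {X : Type*} {col : X → ℕ} {ht : X → ℤ} {m : ℕ}

theorem ColInc.lt_iff (hinj : ∀ x y, col x = col y → ht x = ht y → x = y) {φ : X → Fin m}
    (hφ : ColInc col ht φ) {x y : X} (h : col x = col y) : φ x < φ y ↔ ht x < ht y := by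
  refine ⟨fun hlt => ?_, hφ x y h⟩
  by_contra hn
  rcases (not_lt.1 hn).lt_or_eq with h1 | h1
  · exact lt_asymm hlt (hφ y x h.symm h1)
  · rw [hinj y x h.symm h1] at hlt
    exact lt_irrefl _ hlt

theorem ColInc.injective (hinj : ∀ x y, col x = col y → ht x = ht y → x = y) {φ : X → Fin m}
    (hφ : ColInc col ht φ) : Function.Injective fun x => (col x, φ x) := by
  intro x y h
  simp only [Prod.mk.injEq] at h
  refine hinj x y h.1 (le_antisymm ?_ ?_) <;> by_contra hn
  · exact (hφ y x h.1.symm (not_le.1 hn)).ne' h.2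
  · exact (hφ x y h.1 (not_le.1 hn)).ne h.2

variable [Fintype X]

theorem ColInc.card_filter (hinj : ∀ x y, col x = col y → ht x = ht y → x = y) {φ : X → Fin m}
    (hφ : ColInc col ht φ) (P : ℕ × Fin m → Prop) [DecidablePred P] :
    #{x | P (col x, φ x)} = #{p ∈ labelPairs col φ | P p} := by
  rw [labelPairs, filter_image, card_image_of_injective _ (hφ.injective hinj)]

theorem ColInc.lt_label_iff (hinj : ∀ x y, col x = col y → ht x = ht y → x = y)
    {φ : X → Fin m} (hφ : ColInc col ht φ) (x : X) (ℓ : Fin m) :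
    φ x < ℓ ↔ #{y | col y = col x ∧ ht y < ht x} < #{p ∈ labelPairs col φ |
      p.1 = col x ∧ p.2 < ℓ} := by
  rw [← hφ.card_filter hinj fun p => p.1 = col x ∧ p.2 < ℓ]
  constructor
  · intro h
    refine card_lt_card ⟨fun y hy => ?_, fun hsub => ?_⟩
    · simp only [mem_filter, mem_univ, true_and] at hy ⊢
      exact ⟨hy.1, ((hφ.lt_iff hinj hy.1).2 hy.2).trans h⟩
    · have := @hsub x (by simpa using h)
      simp at this
  · contrapose!
    intro h
    refine card_le_card fun y hy => ?_
    simp only [mem_filter, mem_univ, true_and] at hy ⊢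
    exact ⟨hy.1, (hφ.lt_iff hinj hy.1).1 (hy.2.trans_le h)⟩

theorem ColInc.card_label_lt (hinj : ∀ x y, col x = col y → ht x = ht y → x = y)
    {φ : X → Fin m} (hφ : ColInc col ht φ) (x : X) :
    #{p ∈ labelPairs col φ | p.1 = col x ∧ p.2 < φ x} = #{y | col y = col x ∧ ht y < ht x} := by
  rw [← hφ.card_filter hinj fun p => p.1 = col x ∧ p.2 < φ x]
  congr 1
  ext y
  simp only [mem_filter, mem_univ, true_and]
  exact and_congr_right fun h => hφ.lt_iff hinj h

theorem ColInc.eq_of_labelPairs_eq (hinj : ∀ x y, col x = col y → ht x = ht y → x = y)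
    {φ ψ : X → Fin m} (hφ : ColInc col ht φ) (hψ : ColInc col ht ψ)
    (h : labelPairs col φ = labelPairs col ψ) : φ = ψ := by
  funext x
  by_contra hne
  wlog hlt : φ x < ψ x generalizing φ ψ
  · exact this hψ hφ h.symm (Ne.symm hne) ((not_lt.1 hlt).lt_of_ne (Ne.symm hne))
  have h1 := (hφ.lt_label_iff hinj x (ψ x)).1 hlt
  rw [h, hψ.card_label_lt hinj] at h1
  exact lt_irrefl _ h1

theorem exists_colInc (hinj : ∀ x y, col x = col y → ht x = ht y → x = y)
    (I : Finset (ℕ × Fin m)) (hI : ∀ i, #{p ∈ I | p.1 = i} = #{x | col x = i}) :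
    ∃ φ : X → Fin m, ColInc col ht φ ∧ labelPairs col φ = I := by
  set S : ℕ → Finset (Fin m) := fun i => {p ∈ I | p.1 = i}.image Prod.snd with hS
  have hmem : ∀ i ℓ, ℓ ∈ S i ↔ (i, ℓ) ∈ I := by
    intro i ℓ
    simp [hS]
  have hcard : ∀ i, #(S i) = #{x | col x = i} := by
    intro i
    rw [← hI, hS, card_image_of_injOn]
    intro p hp q hq h
    simp only [coe_filter, Set.mem_ofPred_eq] at hp hq
    exact Prod.ext (hp.2.trans hq.2.symm) h
  have hrank : ∀ x, #{y | col y = col x ∧ ht y < ht x} < #{y | col y = col x} := by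
    intro x
    refine card_lt_card ⟨fun y hy => ?_, fun hsub => ?_⟩
    · simp only [mem_filter, mem_univ, true_and] at hy ⊢
      exact hy.1
    · have := @hsub x (by simp)
      simp at this
  set φ : X → Fin m := fun x => (S (col x)).orderEmbOfFin (hcard (col x))
    ⟨#{y | col y = col x ∧ ht y < ht x}, hrank x⟩ with hφdef
  have hφ : ColInc col ht φ := by
    intro x y h hlt
    have hval : ∀ i (hi : col x = i), φ x = (S i).orderEmbOfFin (hcard i)
        ⟨#{y | col y = col x ∧ ht y < ht x}, hi ▸ hrank x⟩ := by
      rintro i rfl; rfl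
    rw [hval (col y) h, hφdef]
    simp only [OrderEmbedding.lt_iff_lt, Fin.mk_lt_mk]
    refine card_lt_card ⟨fun z hz => ?_, fun hsub => ?_⟩
    · simp only [mem_filter, mem_univ, true_and] at hz ⊢
      exact ⟨hz.1.trans h, hz.2.trans hlt⟩
    · have := @hsub x (by simp [h, hlt])
      simp at this
  have hsub : labelPairs col φ ⊆ I := by
    intro p hp
    obtain ⟨x, h1, h2⟩ := mem_labelPairs.1 hp
    have : (col x, φ x) ∈ I := (hmem _ _).1 (orderEmbOfFin_mem _ _ _)
    rwa [h1, h2] at this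
  refine ⟨φ, hφ, eq_of_subset_of_card_le hsub ?_⟩
  rw [labelPairs, card_image_of_injective _ (hφ.injective hinj), card_univ]
  have h1 : #I = ∑ i ∈ I.image Prod.fst, #{p ∈ I | p.1 = i} :=
    card_eq_sum_card_image _ _
  rw [h1, sum_congr rfl fun i _ => hI i, ← card_biUnion]
  · exact card_le_univ _
  · intro i _ j _ hij
    rw [Function.onFun, disjoint_filter]
    rintro x - rfl
    exact hij

end Columns

theorem sum_Ico_triangle_comm (k : ℕ) (F : ℕ → ℕ → ℤ) :
    ∑ j ∈ range k, ∑ i ∈ Ico (j + 1) k, F j i = ∑ j ∈ range k, ∑ i ∈ range j, F i j := by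
  induction k with
  | zero => simp
  | succ k ih =>
    rw [sum_range_succ (fun j => ∑ i ∈ range j, F i j), ← ih, sum_range_succ]
    simp only [Ico_self, sum_empty, add_zero]
    rw [← sum_add_distrib]
    refine sum_congr rfl fun j hj => ?_
    rw [sum_Ico_succ_top (by have := mem_range.1 hj; omega)]

theorem sum_erase_range {k j : ℕ} (hj : j < k) (F : ℕ → ℤ) :
    ∑ i ∈ (range k).erase j, F i = ∑ i ∈ range j, F i + ∑ i ∈ Ico (j + 1) k, F i := by
  have h1 := sum_erase_add (range k) F (mem_range.2 hj)
  have h2 := sum_range_add_sum_Ico F (show j + 1 ≤ k from hj)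
  rw [sum_range_succ] at h2
  omega

theorem sum_shift_eq {F : ℕ → ℤ} (j : ℕ) (h : F j = F 0) :
    ∑ i ∈ range j, F (i + 1) = ∑ i ∈ range j, F i := by
  have h1 := sum_range_succ F j
  rw [sum_range_succ'] at h1
  omega

theorem sum_Ico_ite_le (a : ℤ) {p q : ℕ} (h : p ≤ q) :
    ∑ y ∈ Ico p q, (if a ≤ (y : ℤ) then (1 : ℤ) else 0) = max (q - a) 0 - max (p - a) 0 := by
  induction q, h using Nat.le_induction with
  | base => simp
  | succ q hq ih =>
    rw [sum_Ico_succ_top hq, ih]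
    split_ifs <;> push_cast <;> omega

theorem sum_max_triangle (k : ℕ) (c : ℤ) (α : ℕ → ℤ) (h0 : α 0 = 0)
    (hk0 : α k = 0) (hnn : ∀ i, i ≤ k → 0 ≤ α i) (hc : 0 ≤ c)
    (hstep : ∀ j, j < k → α j ≤ α (j + 1) + c) :
    ∑ j ∈ range k, (∑ i ∈ range j, (max (α (j + 1) + c - α (i + 1) + 1) 0 -
        max (α j - α (i + 1) + 1) 0) +
      ∑ i ∈ Ico (j + 1) k, (max (α (j + 1) - α (i + 1) - 1) 0 -
        max (α j - α (i + 1) - c - 1) 0)) =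
    ∑ j ∈ range k, ∑ i ∈ range k, (max (α (j + 1) + 1 - α i - if j < i then 1 else 0) 0 -
        max (α j - α i - if j < i then 1 else 0) 0) - k +
      (c - 1) * ∑ j ∈ range k, (j : ℤ) := by
  have hZ : ∑ i ∈ range k, max (1 - α (i + 1)) 0 = ∑ i ∈ range k, max (1 - α i) 0 :=
    sum_shift_eq (F := fun i => max (1 - α i) 0) k (by simp [h0, hk0])
  have hL3 : ∑ j ∈ range k, ∑ i ∈ range j, max (α j - α (i + 1) + 1) 0 +
      ∑ i ∈ range k, max (1 - α i) 0 =
      ∑ j ∈ range k, ∑ i ∈ range j, max (α (j + 1) - α (i + 1) + 1) 0 + k := by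
    have h1 := sum_range_succ (fun j => ∑ i ∈ range j, max (α j - α (i + 1) + 1) 0) k
    rw [sum_range_succ'] at h1
    simp only [range_zero, sum_empty, add_zero, sum_range_succ _ _, sub_self, zero_add, hk0,
      sum_add_distrib] at h1
    simp only [max_eq_left zero_le_one, sum_const, card_range, nsmul_eq_mul, mul_one] at h1
    rw [h1, ← hZ]
    congr 1
    exact sum_congr rfl fun i _ => by congr 1; ring
  have hR1 : ∑ j ∈ range k, (∑ i ∈ range j, max (α (j + 1) + 1 - α i) 0 +
      max (α (j + 1) + 1 - α j) 0) =
      ∑ j ∈ range k, ∑ i ∈ range j, max (α j + 1 - α i) 0 + ∑ i ∈ range k, max (1 - α i) 0 := by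
    have h1 := sum_range_succ (fun j => ∑ i ∈ range j, max (α j + 1 - α i) 0) k
    rw [sum_range_succ'] at h1
    simp only [range_zero, sum_empty, add_zero, hk0, zero_add] at h1
    rw [← h1]
    exact sum_congr rfl fun j _ => (sum_range_succ _ _).symm
  have hL4 : ∑ j ∈ range k, ∑ i ∈ range j, max (α i - α (j + 1) - c - 1) 0 =
      ∑ j ∈ range k, ∑ i ∈ range j, max (α (i + 1) - α (j + 1) - c - 1) 0 := by
    refine sum_congr rfl fun j hj => Eq.symm ?_
    rw [mem_range] at hj
    refine sum_shift_eq (F := fun i => max (α i - α (j + 1) - c - 1) 0) j ?_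
    have := hstep j hj
    have := hnn (j + 1) hj
    simp only [h0]
    omega
  have hR3 : ∑ j ∈ range k, ∑ i ∈ range j, max (α (i + 1) - α j) 0 =
      ∑ j ∈ range k, ∑ i ∈ range j, max (α i - α j) 0 := by
    refine sum_congr rfl fun j hj => ?_
    rw [mem_range] at hj
    refine sum_shift_eq (F := fun i => max (α i - α j) 0) j ?_
    have := hnn j hj.le
    simp only [h0]
    omega
  have hLHS : ∑ j ∈ range k, (∑ i ∈ range j, (max (α (j + 1) + c - α (i + 1) + 1) 0 -
        max (α j - α (i + 1) + 1) 0) +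
      ∑ i ∈ Ico (j + 1) k, (max (α (j + 1) - α (i + 1) - 1) 0 -
        max (α j - α (i + 1) - c - 1) 0)) =
      ∑ j ∈ range k, ∑ i ∈ range j, c - k + ∑ i ∈ range k, max (1 - α i) 0 := by
    have h1 : ∑ j ∈ range k, ∑ i ∈ range j, c =
        ∑ j ∈ range k, ∑ i ∈ range j, (max (α (j + 1) + c - α (i + 1) + 1) 0 -
          max (α (j + 1) - α (i + 1) + 1) 0 + max (α (i + 1) - α (j + 1) - 1) 0 -
          max (α (i + 1) - α (j + 1) - c - 1) 0) :=
      sum_congr rfl fun j _ => sum_congr rfl fun i _ => by omega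
    rw [sum_add_distrib, sum_Ico_triangle_comm, h1]
    simp only [sum_sub_distrib, sum_add_distrib]
    linarith
  have hRHS : ∑ j ∈ range k, ∑ i ∈ range k,
        (max (α (j + 1) + 1 - α i - if j < i then 1 else 0) 0 -
        max (α j - α i - if j < i then 1 else 0) 0) =
      ∑ j ∈ range k, ∑ i ∈ range j, 1 + ∑ i ∈ range k, max (1 - α i) 0 := by
    have h1 : ∑ j ∈ range k, ∑ i ∈ range j, (1 : ℤ) =
        ∑ j ∈ range k, ∑ i ∈ range j, (max (α j + 1 - α i) 0 - max (α j - α i) 0 +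
          max (α i - α j) 0 - max (α i - α j - 1) 0) :=
      sum_congr rfl fun j _ => sum_congr rfl fun i _ => by omega
    have h2 : ∀ j ∈ range k, ∑ i ∈ range k,
        (max (α (j + 1) + 1 - α i - if j < i then 1 else 0) 0 -
        max (α j - α i - if j < i then 1 else 0) 0) =
        ∑ i ∈ range j, (max (α (j + 1) + 1 - α i) 0 - max (α j - α i) 0) +
        max (α (j + 1) + 1 - α j) 0 +
        ∑ i ∈ Ico (j + 1) k, (max (α (j + 1) - α i) 0 - max (α j - α i - 1) 0) := by
      intro j hj
      rw [mem_range] at hj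
      rw [← sum_range_add_sum_Ico _ (show j + 1 ≤ k from hj), sum_range_succ]
      congr 1
      · congr 1
        · refine sum_congr rfl fun i hi => ?_
          rw [mem_range] at hi
          rw [if_neg (by omega)]
          simp
        · simp
      · refine sum_congr rfl fun i hi => ?_
        rw [mem_Ico] at hi
        rw [if_pos (by omega)]
        congr 2
        ring
    rw [sum_congr rfl h2, sum_add_distrib, sum_Ico_triangle_comm, h1]
    simp only [sum_sub_distrib, sum_add_distrib] at hR1 ⊢
    linarith
  rw [hLHS, hRHS]
  simp only [sum_const, card_range, nsmul_eq_mul, mul_one, ← sum_mul]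
  ring

/-- The numerical identity behind the evaluation of the exponent. -/
theorem sum_max_columns (k : ℕ) (c : ℤ) (α P : ℕ → ℤ) (h0 : α 0 = 0)
    (hk0 : α k = 0) (hnn : ∀ i, i ≤ k → 0 ≤ α i) (hc : 0 ≤ c)
    (hstep : ∀ j, j < k → α j ≤ α (j + 1) + c)
    (hP : ∀ j, j < k → α (j + 1) + 1 ≤ P j) (hP' : ∀ j, j < k → α j ≤ P j) :
    ∑ j ∈ range k, ∑ i ∈ range j, (max (α (j + 1) + c - α (i + 1) + 1) 0 -
        max (α j - α (i + 1) + 1) 0 - (max (α (j + 1) - α (i + 1)) 0 -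
        max (α j - α (i + 1) - c) 0)) +
      ∑ j ∈ range k, ∑ i ∈ (range k).erase j,
        (max (P j - α (i + 1) - if j < i then 1 else 0) 0 -
          max (α (j + 1) + 1 - α (i + 1) - if j < i then 1 else 0) 0) +
      ∑ j ∈ range k, ∑ i ∈ (range k).erase j,
        (max (α (j + 1) - α (i + 1) - if j < i then 1 else 0) 0 -
          max (α j - α (i + 1) - c - if j < i then 1 else 0) 0) =
    ∑ j ∈ range k, ∑ i ∈ (range k).erase j,
        (max (P j - α i - if j < i then 1 else 0) 0 -
          max (α j - α i - if j < i then 1 else 0) 0) +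
      (c - 1) * ∑ j ∈ range k, (j : ℤ) := by
  have hmain := sum_max_triangle k c α h0 hk0 hnn hc hstep
  have hsplit : ∀ (F : ℤ → ℤ → ℕ → ℤ), ∀ j ∈ range k,
      ∑ i ∈ (range k).erase j, F (α (i + 1)) (if j < i then 1 else 0) j =
      ∑ i ∈ range j, F (α (i + 1)) 0 j + ∑ i ∈ Ico (j + 1) k, F (α (i + 1)) 1 j := by
    intro F j hj
    rw [sum_erase_range (mem_range.1 hj)]
    congr 1
    · exact sum_congr rfl fun i hi => by rw [if_neg (by have := mem_range.1 hi; omega)]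
    · exact sum_congr rfl fun i hi => by rw [if_pos (by have := (mem_Ico.1 hi).1; omega)]
  have h3 : ∑ j ∈ range k, ∑ i ∈ range j, (max (α (j + 1) + c - α (i + 1) + 1) 0 -
        max (α j - α (i + 1) + 1) 0 - (max (α (j + 1) - α (i + 1)) 0 -
        max (α j - α (i + 1) - c) 0)) +
      ∑ j ∈ range k, ∑ i ∈ (range k).erase j,
        (max (α (j + 1) - α (i + 1) - if j < i then 1 else 0) 0 -
          max (α j - α (i + 1) - c - if j < i then 1 else 0) 0) =
      ∑ j ∈ range k, (∑ i ∈ range j, (max (α (j + 1) + c - α (i + 1) + 1) 0 -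
        max (α j - α (i + 1) + 1) 0) +
      ∑ i ∈ Ico (j + 1) k, (max (α (j + 1) - α (i + 1) - 1) 0 -
        max (α j - α (i + 1) - c - 1) 0)) := by
    rw [← sum_add_distrib]
    refine sum_congr rfl fun j hj => ?_
    rw [hsplit (fun x e j => max (α (j + 1) - x - e) 0 - max (α j - x - c - e) 0) j hj]
    simp only [sub_zero, sum_sub_distrib]
    ring
  have h2 : ∀ j ∈ range k, ∑ i ∈ (range k).erase j,
        (max (P j - α (i + 1) - if j < i then 1 else 0) 0 -
          max (α (j + 1) + 1 - α (i + 1) - if j < i then 1 else 0) 0) =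
      ∑ i ∈ (range k).erase j, (max (P j - α i - if j < i then 1 else 0) 0 -
          max (α j - α i - if j < i then 1 else 0) 0) -
      ∑ i ∈ range k, (max (α (j + 1) + 1 - α i - if j < i then 1 else 0) 0 -
        max (α j - α i - if j < i then 1 else 0) 0) + (α (j + 1) + 1 - α j) := by
    intro j hj
    have hjk := mem_range.1 hj
    rw [hsplit (fun x e j => max (P j - x - e) 0 - max (α (j + 1) + 1 - x - e) 0) j hj]
    have e1 := sum_erase_add (range k) (fun i => max (P j - α i - if j < i then 1 else 0) 0 -
          max (α j - α i - if j < i then 1 else 0) 0) hj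
    have e2 : ∑ i ∈ range k, (max (P j - α i - if j < i then 1 else 0) 0 -
          max (α j - α i - if j < i then 1 else 0) 0) =
        ∑ i ∈ range k, (max (P j - α i - if j < i then 1 else 0) 0 -
          max (α (j + 1) + 1 - α i - if j < i then 1 else 0) 0) +
        ∑ i ∈ range k, (max (α (j + 1) + 1 - α i - if j < i then 1 else 0) 0 -
          max (α j - α i - if j < i then 1 else 0) 0) := by
      rw [← sum_add_distrib]
      exact sum_congr rfl fun i _ => by ring
    have e3 : ∑ i ∈ range k, (max (P j - α i - if j < i then 1 else 0) 0 -
          max (α (j + 1) + 1 - α i - if j < i then 1 else 0) 0) =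
        ∑ i ∈ range (j + 1), (max (P j - α i) 0 - max (α (j + 1) + 1 - α i) 0) +
        ∑ i ∈ Ico (j + 1) k, (max (P j - α i - 1) 0 - max (α (j + 1) + 1 - α i - 1) 0) := by
      rw [← sum_range_add_sum_Ico _ (show j + 1 ≤ k from hjk)]
      congr 1
      · refine sum_congr rfl fun i hi => ?_
        rw [if_neg (by have := mem_range.1 hi; omega)]
        simp
      · exact sum_congr rfl fun i hi => by rw [if_pos (by have := (mem_Ico.1 hi).1; omega)]
    have e4 := sum_range_succ' (fun i => max (P j - α i) 0 - max (α (j + 1) + 1 - α i) 0) j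
    have e5 : ∑ i ∈ Ico (j + 1) k,
        (max (P j - α (i + 1) - 1) 0 - max (α (j + 1) + 1 - α (i + 1) - 1) 0) =
        ∑ i ∈ Ico (j + 1) k, (max (P j - α i - 1) 0 - max (α (j + 1) + 1 - α i - 1) 0) +
        (max (P j - α k - 1) 0 - max (α (j + 1) + 1 - α k - 1) 0) -
        (max (P j - α (j + 1) - 1) 0 - max (α (j + 1) + 1 - α (j + 1) - 1) 0) := by
      have := sum_Ico_add' (fun i => max (P j - α i - 1) 0 - max (α (j + 1) + 1 - α i - 1) 0)
        (j + 1) k 1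
      rw [this]
      have h6 := sum_eq_sum_Ico_succ_bot (show j + 1 < k + 1 by omega)
        (fun i => max (P j - α i - 1) 0 - max (α (j + 1) + 1 - α i - 1) 0)
      rw [sum_Ico_succ_top (by omega)] at h6
      linarith
    have := hP j hjk
    have := hP' j hjk
    have := hnn (j + 1) hjk
    have f1 : max (P j - α k - 1) 0 - max (α (j + 1) + 1 - α k - 1) 0 = P j - α (j + 1) - 1 := by
      rw [hk0]; omega
    have f2 : max (P j - α (j + 1) - 1) 0 - max (α (j + 1) + 1 - α (j + 1) - 1) 0 =
        P j - α (j + 1) - 1 := by omega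
    have f3 : max (P j - α 0) 0 - max (α (j + 1) + 1 - α 0) 0 = P j - α (j + 1) - 1 := by
      rw [h0]; omega
    have f4 : (max (P j - α j - if j < j then 1 else 0) 0 -
          max (α j - α j - if j < j then 1 else 0) 0) = P j - α j := by
      rw [if_neg (lt_irrefl _)]; omega
    simp only [sub_zero]
    linarith
  have h4 : ∑ j ∈ range k, (α (j + 1) + 1 - α j) = (k : ℤ) := by
    have : ∀ j ∈ range k, α (j + 1) + 1 - α j = (α (j + 1) - α j) + 1 := fun j _ => by ring
    rw [sum_congr rfl this, sum_add_distrib, sum_range_sub, h0, hk0]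
    simp
  rw [sum_congr rfl h2, sum_add_distrib, sum_sub_distrib, h4]
  linarith

section Strips

variable {k : ℕ} {lo hi : ℕ → ℕ} {S : Finset (ℕ × ℕ)}

theorem sum_strip (hS : ∀ B, B ∈ S ↔ B.1 < k ∧ lo B.1 ≤ B.2 ∧ B.2 < hi B.1)
    {M : Type*} [AddCommMonoid M] (F : ℕ × ℕ → M) :
    ∑ B ∈ S, F B = ∑ j ∈ range k, ∑ y ∈ Ico (lo j) (hi j), F (j, y) :=
  sum_finset_product S (range k) (fun j => Ico (lo j) (hi j)) (by simp [hS])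

/-- The boxes of a strip that attack `B` and lie weakly above a given height in each column. -/
theorem card_attack_to (hS : ∀ B, B ∈ S ↔ B.1 < k ∧ lo B.1 ≤ B.2 ∧ B.2 < hi B.1) (c : ℕ)
    (B : ℕ × ℕ) (g : ℕ → ℤ) (hlo : ∀ i, i < k → (lo i : ℤ) ≤ g i)
    (hhi : ∀ i, i < k → g i ≤ hi i) :
    (#{A ∈ S | Attack c A B ∧ g A.1 ≤ A.2} : ℤ) = ∑ i ∈ (range k).erase B.1,
      ((if g i - c * i + (if B.1 < i then 1 else 0) ≤ diagIdx c B then 1 else 0) -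
        if (hi i : ℤ) - c * i + (if B.1 < i then 1 else 0) ≤ diagIdx c B then 1 else 0) := by
  obtain ⟨j, z⟩ := B
  rw [card_filter, Nat.cast_sum, sum_strip hS]
  rw [← sum_subset (erase_subset j (range k))]
  · refine sum_congr rfl fun i hi' => ?_
    simp only [mem_erase, mem_range] at hi'
    have h1 := hlo i hi'.2
    have h2 := hhi i hi'.2
    dsimp only
    obtain ⟨e, he, he'⟩ : ∃ e : ℤ, (if j < i then (1 : ℤ) else 0) = e ∧
        (e = 1 ∧ j < i ∨ e = 0 ∧ i < j) := by
      refine ⟨_, rfl, ?_⟩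
      split_ifs <;> omega
    rw [he]
    have key : ∀ y ∈ Ico (lo i) (hi i), ((if Attack c (i, y) (j, z) ∧ g i ≤ y then 1 else 0 : ℕ) : ℤ) =
        if y = (z - c * j + c * i - e : ℤ).toNat then (if g i ≤ z - c * j + c * i - e then 1 else 0)
          else 0 := by
      intro y hy
      rw [mem_Ico] at hy
      rw [if_congr (show Attack c (i, y) (j, z) ∧ g i ≤ y ↔
        ((y : ℤ) - c * i = z - c * j ∧ i < j ∨ (y : ℤ) - c * i = z - c * j - 1 ∧ j < i) ∧
          g i ≤ y from Iff.rfl) rfl rfl]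
      split_ifs <;> omega
    refine (sum_congr rfl key).trans ?_
    rw [sum_ite_eq']
    simp only [mem_Ico, diagIdx]
    split_ifs <;> omega
  · intro i _ hi'
    have : i = j := by
      by_contra hne
      exact hi' (mem_erase.2 ⟨hne, ‹_›⟩)
    subst this
    simp [Attack]

/-- The boxes of a strip that `B` attacks and that lie below a given height in each column. -/
theorem card_attack_from (hS : ∀ B, B ∈ S ↔ B.1 < k ∧ lo B.1 ≤ B.2 ∧ B.2 < hi B.1) (c : ℕ)
    (B : ℕ × ℕ) (g : ℕ → ℤ) (hlo : ∀ i, i < k → (lo i : ℤ) ≤ g i)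
    (hhi : ∀ i, i < k → g i ≤ hi i) :
    (#{A ∈ S | Attack c B A ∧ (A.2 : ℤ) < g A.1} : ℤ) = ∑ i ∈ (range k).erase B.1,
      ((if (lo i : ℤ) - c * i + (if B.1 < i then 1 else 0) ≤ diagIdx c B + 1 then 1 else 0) -
        if g i - c * i + (if B.1 < i then 1 else 0) ≤ diagIdx c B + 1 then 1 else 0) := by
  obtain ⟨j, z⟩ := B
  rw [card_filter, Nat.cast_sum, sum_strip hS]
  rw [← sum_subset (erase_subset j (range k))]
  · refine sum_congr rfl fun i hi' => ?_
    simp only [mem_erase, mem_range] at hi'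
    have h1 := hlo i hi'.2
    have h2 := hhi i hi'.2
    dsimp only
    obtain ⟨e, he, he'⟩ : ∃ e : ℤ, (if j < i then (1 : ℤ) else 0) = e ∧
        (e = 1 ∧ j < i ∨ e = 0 ∧ i < j) := by
      refine ⟨_, rfl, ?_⟩
      split_ifs <;> omega
    rw [he]
    have key : ∀ y ∈ Ico (lo i) (hi i), ((if Attack c (j, z) (i, y) ∧ (y : ℤ) < g i then 1 else 0 : ℕ) : ℤ) =
        if y = (z - c * j + c * i + 1 - e : ℤ).toNat then
          (if (lo i : ℤ) ≤ z - c * j + c * i + 1 - e ∧ z - c * j + c * i + 1 - e < g i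
            then 1 else 0) else 0 := by
      intro y hy
      rw [mem_Ico] at hy
      rw [if_congr (show Attack c (j, z) (i, y) ∧ (y : ℤ) < g i ↔
        ((z : ℤ) - c * j = y - c * i ∧ j < i ∨ (z : ℤ) - c * j = y - c * i - 1 ∧ i < j) ∧
          (y : ℤ) < g i from Iff.rfl) rfl rfl]
      split_ifs <;> omega
    refine (sum_congr rfl key).trans ?_
    rw [sum_ite_eq']
    simp only [mem_Ico, diagIdx]
    split_ifs <;> omega
  · intro i _ hi'
    have : i = j := by
      by_contra hne
      exact hi' (mem_erase.2 ⟨hne, ‹_›⟩)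
    subst this
    simp [Attack]

end Strips

theorem key_lt_of_attack (c : ℕ) {k : ℕ} {A B : ℕ × ℕ} (hA : A.1 < k) (h : Attack c A B) :
    (k : ℤ) * diagIdx c A + A.1 < k * diagIdx c B + B.1 := by
  rcases h with ⟨h1, h2⟩ | ⟨h1, h2⟩
  · rw [h1]; omega
  · rw [h1]; rw [mul_sub]; omega

theorem maxtdinvD_eq (c K k : ℕ) (H : ℕ → ℕ) :
    maxtdinvD c K k H = #(attackPairsOn c (boxesD K k H)) := by
  have hle : ∀ L : ℕ × ℕ → ℕ, tdinvOn c (boxesD K k H) L ≤ #(attackPairsOn c (boxesD K k H)) :=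
    fun L => card_le_card fun p => by
      simp only [attackPairsOn, mem_filter]
      tauto
  refine le_antisymm (csSup_le' ?_) (le_csSup ⟨#(attackPairsOn c (boxesD K k H)), ?_⟩ ?_)
  · rintro m ⟨L, _, rfl⟩
    exact hle L
  · rintro m ⟨L, _, rfl⟩
    exact hle L
  · have hpos : ∀ A : ℕ × ℕ, A.1 < k → 0 < (k : ℤ) * diagIdx c A + A.1 + (k * (c * k) + 1) := by
      intro A hA
      have : (c : ℤ) * A.1 ≤ c * k := by gcongr
      have h3 : (0 : ℤ) ≤ k * (diagIdx c A + c * k) := by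
        apply mul_nonneg (by positivity)
        simp only [diagIdx]
        omega
      rw [mul_add] at h3
      omega
    have hmem : ∀ {A}, A ∈ boxesD K k H → A.1 < k := fun h => by
      simp only [boxesD, mem_filter, mem_product, mem_range] at h
      exact h.1.1
    refine ⟨fun A => ((k : ℤ) * diagIdx c A + A.1 + (k * (c * k) + 1)).toNat, ⟨?_, ?_⟩, ?_⟩
    · intro A hA
      exact Nat.pos_of_ne_zero (by simpa using hpos A (hmem hA))
    · intro i y hi _ _
      have := hpos (i, y) hi
      simp only [diagIdx] at this ⊢
      push_cast
      have h2 : (k : ℤ) * (y + 1 - c * i) = k * (y - c * i) + k := by ring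
      rw [h2]
      omega
    · rw [tdinvOn, attackPairsOn]
      congr 1
      refine filter_congr fun p hp => ⟨fun h => h.1, fun h => ⟨h, ?_⟩⟩
      rw [mem_product] at hp
      have := key_lt_of_attack c (hmem hp.1) h
      have := hpos _ (hmem hp.1)
      omega

theorem sum_range_eq_sum_columns {H : ℕ → ℕ} (hH0 : H 0 = 0) (hmono : Monotone H) (k : ℕ)
    (F : ℕ → ℤ) : ∑ y ∈ range (H k), F y = ∑ j ∈ range k, ∑ y ∈ Ico (H j) (H (j + 1)), F y := by
  induction k with
  | zero => simp [hH0]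
  | succ k ih => rw [sum_range_succ, ← ih, sum_range_add_sum_Ico F (hmono k.le_succ)]

theorem armD_eq {k : ℕ} {H : ℕ → ℕ} (hmono : Monotone H) {i j y : ℕ} (hj : j < k)
    (h1 : H j ≤ y) (h2 : y < H (j + 1)) : armD k H (i, y) = j - i - 1 := by
  rw [armD, ← Nat.card_Ioo]
  congr 1
  ext l
  simp only [mem_filter, mem_Ioo]
  constructor
  · rintro ⟨⟨h3, h4⟩, h5⟩
    refine ⟨h3, ?_⟩
    by_contra hlj
    have := hmono (show j + 1 ≤ l + 1 by omega)
    omega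
  · rintro ⟨h3, h4⟩
    exact ⟨⟨h3, h4.trans hj⟩, (hmono h4).trans h1⟩

theorem pathdinvD_eq {c k : ℕ} {H : ℕ → ℕ} (hH0 : H 0 = 0) (hmono : Monotone H)
    (hK : H k = k * c) :
    (pathdinvD (k * c) k H : ℤ) = ∑ j ∈ range k, ∑ i ∈ range j, ∑ y ∈ Ico (H j) (H (j + 1)),
      ((if (H (i + 1) : ℤ) - c * i + c * j - c - 1 ≤ y then 1 else 0) -
        if (H (i + 1) : ℤ) - c * i + c * j ≤ y then 1 else 0) := by
  rw [pathdinvD, card_filter, Nat.cast_sum, sum_product_right, ← hK,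
    sum_range_eq_sum_columns hH0 hmono]
  refine sum_congr rfl fun j hj => ?_
  rw [mem_range] at hj
  rw [sum_comm (s := range j)]
  refine sum_congr rfl fun y hy => ?_
  rw [mem_Ico] at hy
  rw [← sum_subset (range_subset_range.2 hj.le)]
  · refine sum_congr rfl fun i hi => ?_
    rw [mem_range] at hi
    have hk : 0 < k := by omega
    have h1 : H (i + 1) ≤ y := (hmono hi).trans hy.1
    have hleg : (legD H (i, y) : ℤ) = y - H (i + 1) := by simp only [legD]; omega
    have harm : armD k H (i, y) = j - i - 1 := armD_eq hmono hj hy.1 hy.2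
    have e1 : armD k H (i, y) * (k * c) ≤ k * (legD H (i, y) + 1) ↔
        (c : ℤ) * j - c * i - c ≤ y - H (i + 1) + 1 := by
      rw [mul_left_comm, Nat.mul_le_mul_left_iff hk, ← hleg, harm,
        show (c : ℤ) * j - c * i - c = ((j - i - 1 : ℕ) : ℤ) * c by
          rw [Nat.sub_sub, Nat.cast_sub hi]; push_cast; ring]
      norm_cast
    have e2 : k * legD H (i, y) < (armD k H (i, y) + 1) * (k * c) ↔
        (y : ℤ) - H (i + 1) < c * j - c * i := by
      rw [mul_left_comm, Nat.mul_lt_mul_left hk, ← hleg, harm,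
        show (c : ℤ) * j - c * i = ((j - i - 1 + 1 : ℕ) : ℤ) * c by
          rw [Nat.sub_sub, Nat.cast_succ, Nat.cast_sub hi]; push_cast; ring]
      norm_cast
    have hc : (0 : ℤ) ≤ c := by positivity
    rw [if_congr (and_congr_right' (and_congr (hK ▸ e1) (hK ▸ e2))) rfl rfl]
    dsimp only
    split_ifs <;> omega
  · intro i _ hi
    rw [mem_range, not_lt] at hi
    have := hmono (show j + 1 ≤ i + 1 by omega)
    rw [if_neg]
    · rfl
    · dsimp only
      omega

theorem pathdinvD_add_sums {n k : ℕ} (hk : 1 ≤ k) {H b : ℕ → ℕ}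
    (hD : IsDyck (k * (n - k + 1)) k H) (hb : IsBigTuple n k H b) (hadm : AdmissibleB n k b) :
    (pathdinvD (k * (n - k + 1)) k H : ℤ) +
      ∑ j ∈ range k, ∑ y ∈ Ico (H (j + 1) - (n - k)) (H (j + 1) - b j),
        ∑ i ∈ (range k).erase j,
          (if ((H (i + 1) - (n - k) : ℕ) : ℤ) - (n - k + 1 : ℕ) * i + (if j < i then 1 else 0) ≤
            diagIdx (n - k + 1) (j, y) + 1 then (1 : ℤ) else 0) +
      ∑ j ∈ range k, ∑ y ∈ Ico (H j) (H (j + 1)), ∑ i ∈ (range k).erase j,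
        (if (H (i + 1) : ℤ) - (n - k + 1 : ℕ) * i + (if j < i then 1 else 0) ≤
          diagIdx (n - k + 1) (j, y) then (1 : ℤ) else 0) =
    ∑ j ∈ range k, ∑ y ∈ Ico (H j) (H (j + 1) - b j), ∑ i ∈ (range k).erase j,
        (if (H i : ℤ) - (n - k + 1 : ℕ) * i + (if j < i then 1 else 0) ≤
          diagIdx (n - k + 1) (j, y) then (1 : ℤ) else 0) +
      (n - k : ℕ) * ∑ j ∈ range k, (j : ℤ) := by
  obtain ⟨hH0, hmono, hHK, hdy⟩ := hD
  set m := n - k with hm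
  set c := m + 1 with hc
  have hHc : ∀ i, i ≤ k → c * i ≤ H i := fun i hi => by
    have := hdy i hi
    rw [mul_assoc] at this
    exact Nat.le_of_mul_le_mul_left this hk
  have hHm : ∀ i, i < k → m ≤ H (i + 1) := fun i hi => by
    have := hHc (i + 1) hi
    rw [mul_add] at this
    omega
  have hbH : ∀ j, j < k → b j + H j ≤ H (j + 1) := fun j hj => by
    have := hb.1 j hj
    have := hmono (Nat.le_add_right j 1)
    omega
  have hmax := sum_max_columns k c (fun i => (H i : ℤ) - c * i)
    (fun j => (H (j + 1) : ℤ) - b j - c * j) (by simp [hH0])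
    (by simp only [hHK k le_rfl]; push_cast; ring)
    (fun i hi => by have := hHc i hi; zify at this; linarith) (by positivity)
    (fun j hj => by
      have := hmono (Nat.le_add_right j 1)
      zify at this
      push_cast
      linarith)
    (fun j hj => by
      have := hadm j hj
      rw [hc]
      push_cast
      linarith)
    (fun j hj => by
      have := hbH j hj
      zify at this
      linarith)
  rw [pathdinvD_eq hH0 hmono (hHK k le_rfl)]
  rw [show ((c : ℤ) - 1) = m by rw [hc]; push_cast; ring] at hmax
  refine Eq.trans (congrArg₂ _ (congrArg₂ _ ?_ ?_) ?_) (hmax.trans (congrArg₂ _ ?_ rfl))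
  · refine sum_congr rfl fun j hj => sum_congr rfl fun i hi => ?_
    rw [sum_sub_distrib, sum_Ico_ite_le _ (hmono (Nat.le_add_right j 1)), sum_Ico_ite_le _ (hmono (Nat.le_add_right j 1))]
    push_cast
    congr 2 <;> congr 1 <;> ring
  · refine sum_congr rfl fun j hj => ?_
    rw [mem_range] at hj
    rw [sum_comm]
    refine sum_congr rfl fun i hi => ?_
    rw [mem_erase, mem_range] at hi
    have hiff : ∀ y : ℕ, (((H (i + 1) - m : ℕ) : ℤ) - c * i + (if j < i then 1 else 0) ≤
        diagIdx c (j, y) + 1 ↔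
        (H (i + 1) : ℤ) - m - c * i + (if j < i then 1 else 0) + c * j - 1 ≤ y) := fun y => by
      rw [Nat.cast_sub (hHm i hi.2), diagIdx]
      constructor <;> intro h <;> dsimp only at h ⊢ <;> linarith
    simp only [hiff]
    rw [sum_Ico_ite_le _ (Nat.sub_le_sub_left (hadm j hj) _), Nat.cast_sub (hHm j hj),
      Nat.cast_sub ((Nat.le_add_right _ _).trans (hbH j hj))]
    push_cast
    congr 2 <;> rw [hc] <;> push_cast <;> ring
  · refine sum_congr rfl fun j hj => ?_
    rw [sum_comm]
    refine sum_congr rfl fun i hi => ?_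
    have hiff : ∀ y : ℕ, ((H (i + 1) : ℤ) - c * i + (if j < i then 1 else 0) ≤
        diagIdx c (j, y) ↔
        (H (i + 1) : ℤ) - c * i + (if j < i then 1 else 0) + c * j ≤ y) := fun y => by
      rw [diagIdx]
      constructor <;> intro h <;> dsimp only at h ⊢ <;> linarith
    simp only [hiff]
    rw [sum_Ico_ite_le _ (hmono (Nat.le_add_right j 1))]
    push_cast
    congr 2 <;> ring
  · refine sum_congr rfl fun j hj => ?_
    rw [mem_range] at hj
    rw [sum_comm]
    refine sum_congr rfl fun i hi => ?_
    have hiff : ∀ y : ℕ, ((H i : ℤ) - c * i + (if j < i then 1 else 0) ≤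
        diagIdx c (j, y) ↔
        (H i : ℤ) - c * i + (if j < i then 1 else 0) + c * j ≤ y) := fun y => by
      rw [diagIdx]
      constructor <;> intro h <;> dsimp only at h ⊢ <;> linarith
    simp only [hiff]
    rw [sum_Ico_ite_le _ (by have := hbH j hj; omega),
      Nat.cast_sub ((Nat.le_add_right _ _).trans (hbH j hj))]
    congr 2 <;> ring

theorem ColInc.sum_labelPairs {X : Type*} [Fintype X] {col : X → ℕ} {ht : X → ℤ} {m : ℕ}
    (hinj : ∀ x y, col x = col y → ht x = ht y → x = y) {φ : X → Fin m} (hφ : ColInc col ht φ)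
    {M : Type*} [AddCommMonoid M] (F : ℕ × Fin m → M) :
    ∑ p ∈ labelPairs col φ, F p = ∑ x, F (col x, φ x) := by
  rw [labelPairs, sum_image (hφ.injective hinj).injOn]

/-- The number of labels smaller than `ℓ` in column `i`. -/
def colCount {m : ℕ} (I : Finset (ℕ × Fin m)) (i : ℕ) (ℓ : Fin m) : ℕ :=
  #{p ∈ I | p.1 = i ∧ p.2 < ℓ}

section StripLabelings

variable {k : ℕ} {lo hi : ℕ → ℕ} {S : Finset (ℕ × ℕ)} {m : ℕ}

theorem card_column (hS : ∀ B, B ∈ S ↔ B.1 < k ∧ lo B.1 ≤ B.2 ∧ B.2 < hi B.1) {i : ℕ} (hi' : i < k)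
    (P : ℕ → Prop) [DecidablePred P] :
    #{y : {x // x ∈ S} | y.1.1 = i ∧ P y.1.2} = #{y ∈ Ico (lo i) (hi i) | P y} := by
  refine card_bij (fun y _ => y.1.2) ?_ ?_ ?_
  · rintro ⟨⟨j, z⟩, hy⟩ h
    simp only [mem_filter, mem_univ, true_and] at h
    obtain ⟨rfl, h⟩ := h
    have := (hS _).1 hy
    simp only [mem_filter, mem_Ico]
    exact ⟨this.2, h⟩
  · rintro ⟨⟨j, z⟩, hy⟩ h ⟨⟨j', z'⟩, hy'⟩ h' heq
    simp only [mem_filter, mem_univ, true_and] at h h'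
    simp only at heq
    simp only [Subtype.mk.injEq, Prod.mk.injEq]
    exact ⟨h.1.trans h'.1.symm, heq⟩
  · intro z hz
    simp only [mem_filter, mem_Ico] at hz
    exact ⟨⟨(i, z), (hS _).2 ⟨hi', hz.1⟩⟩, by simpa using hz.2, rfl⟩

theorem card_column_eq (hS : ∀ B, B ∈ S ↔ B.1 < k ∧ lo B.1 ≤ B.2 ∧ B.2 < hi B.1) (i : ℕ) :
    #{y : {x // x ∈ S} | y.1.1 = i} = if i < k then hi i - lo i else 0 := by
  split_ifs with h
  · simpa using card_column hS h fun _ => True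
  · rw [card_eq_zero, filter_eq_empty_iff]
    rintro y _ rfl
    exact h ((hS _).1 y.2).1

variable (hS : ∀ B, B ∈ S ↔ B.1 < k ∧ lo B.1 ≤ B.2 ∧ B.2 < hi B.1)
  {φ : {x // x ∈ S} → Fin m}

theorem strip_ext (x y : {x // x ∈ S}) (h1 : x.1.1 = y.1.1) (h2 : x.1.2 = y.1.2) : x = y :=
  Subtype.ext (Prod.ext h1 h2)

theorem strip_ext_up (x y : {x // x ∈ S}) (h1 : x.1.1 = y.1.1) (h2 : (x.1.2 : ℤ) = y.1.2) :
    x = y :=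
  strip_ext x y h1 (by exact_mod_cast h2)

theorem strip_ext_down (x y : {x // x ∈ S}) (h1 : x.1.1 = y.1.1)
    (h2 : -(x.1.2 : ℤ) = -y.1.2) : x = y :=
  strip_ext x y h1 (by omega)

include hS

theorem rank_up (x : {x // x ∈ S}) :
    #{y : {x // x ∈ S} | y.1.1 = x.1.1 ∧ (y.1.2 : ℤ) < x.1.2} + lo x.1.1 = x.1.2 := by
  have hx := (hS _).1 x.2
  rw [card_column hS hx.1 fun z => (z : ℤ) < x.1.2]
  rw [show ({y ∈ Ico (lo x.1.1) (hi x.1.1) | (y : ℤ) < x.1.2} : Finset ℕ) =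
    Ico (lo x.1.1) x.1.2 by ext z; simp only [mem_filter, mem_Ico]; omega, Nat.card_Ico]
  omega

theorem rank_down (x : {x // x ∈ S}) :
    #{y : {x // x ∈ S} | y.1.1 = x.1.1 ∧ -(y.1.2 : ℤ) < -x.1.2} + x.1.2 + 1 = hi x.1.1 := by
  have hx := (hS _).1 x.2
  rw [card_column hS hx.1 fun z => -(z : ℤ) < -x.1.2]
  rw [show ({y ∈ Ico (lo x.1.1) (hi x.1.1) | -(y : ℤ) < -x.1.2} : Finset ℕ) =
    Ico (x.1.2 + 1) (hi x.1.1) by ext z; simp only [mem_filter, mem_Ico]; omega, Nat.card_Ico]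
  omega

theorem colCount_le {ht : {x // x ∈ S} → ℤ}
    (hinj : ∀ x y : {x // x ∈ S}, x.1.1 = y.1.1 → ht x = ht y → x = y)
    (hφ : ColInc (fun x : {x // x ∈ S} => x.1.1) ht φ) {i : ℕ} (hi' : i < k) (ℓ : Fin m) :
    colCount (labelPairs (fun x : {x // x ∈ S} => x.1.1) φ) i ℓ ≤ hi i - lo i := by
  rw [colCount, ← hφ.card_filter hinj fun p => p.1 = i ∧ p.2 < ℓ]
  have := card_column_eq hS i
  rw [if_pos hi'] at this
  rw [← this]
  exact card_le_card fun x hx => by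
    simp only [mem_filter, mem_univ, true_and] at hx ⊢
    exact hx.1

theorem card_nonInversions_up (hlo : ∀ i, i < k → lo i ≤ hi i)
    (hφ : ColInc (fun x : {x // x ∈ S} => x.1.1) (fun x => (x.1.2 : ℤ)) φ) (c : ℕ) :
    (#{p : {x // x ∈ S} × {x // x ∈ S} | Attack c p.1.1 p.2.1 ∧ φ p.2 ≤ φ p.1} : ℤ) =
      ∑ p ∈ labelPairs (fun x : {x // x ∈ S} => x.1.1) φ, ∑ i ∈ (range k).erase p.1,
        (if ((lo i : ℤ) + colCount (labelPairs (fun x : {x // x ∈ S} => x.1.1) φ) i p.2) - c * i +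
          (if p.1 < i then 1 else 0) ≤
          ((lo p.1 : ℤ) + colCount (labelPairs (fun x : {x // x ∈ S} => x.1.1) φ) p.1 p.2) -
            c * p.1 then (1 : ℤ) else 0) -
      ∑ B ∈ S, ∑ i ∈ (range k).erase B.1,
        (if (hi i : ℤ) - c * i + (if B.1 < i then 1 else 0) ≤ diagIdx c B then (1 : ℤ) else 0) := by
  set I := labelPairs (fun x : {x // x ∈ S} => x.1.1) φ with hI
  have hle : ∀ (A : {x // x ∈ S}) (ℓ : Fin m),
      ℓ ≤ φ A ↔ (lo A.1.1 : ℤ) + colCount I A.1.1 ℓ ≤ A.1.2 := fun A ℓ => by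
    rw [← not_lt, hφ.lt_label_iff strip_ext_up]
    have := rank_up hS A
    change ¬ _ < colCount I A.1.1 ℓ ↔ _
    omega
  have heq : ∀ B : {x // x ∈ S}, (lo B.1.1 : ℤ) + colCount I B.1.1 (φ B) = B.1.2 := fun B => by
    have h1 := hφ.card_label_lt strip_ext_up B
    have h2 := rank_up hS B
    change colCount I B.1.1 (φ B) = _ at h1
    omega
  rw [← sum_coe_sort S, hI, hφ.sum_labelPairs strip_ext_up, ← hI,
    ← sum_sub_distrib, card_filter, Nat.cast_sum, ← univ_product_univ, sum_product_right]
  refine sum_congr rfl fun B _ => ?_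
  have h1 := card_attack_to hS c B.1 (fun i => (lo i : ℤ) + colCount I i (φ B))
    (fun i _ => by simp) (fun i hi' => by
      have h2 : colCount I i (φ B) ≤ _ := colCount_le hS strip_ext_up hφ hi' (φ B)
      have := hlo i hi'
      omega)
  rw [← sum_sub_distrib]
  dsimp only at h1 ⊢
  rw [heq B]
  refine Eq.trans ?_ h1
  rw [card_filter, ← sum_coe_sort S, Nat.cast_sum]
  refine sum_congr rfl fun A _ => ?_
  congr 1
  exact if_congr (and_congr_right' (hle A _)) rfl rfl

theorem card_nonInversions_down (hlo : ∀ i, i < k → lo i ≤ hi i)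
    (hφ : ColInc (fun x : {x // x ∈ S} => x.1.1) (fun x => -(x.1.2 : ℤ)) φ) (c : ℕ) :
    (#{p : {x // x ∈ S} × {x // x ∈ S} | Attack c p.1.1 p.2.1 ∧ φ p.1 ≤ φ p.2} : ℤ) =
      ∑ B ∈ S, ∑ i ∈ (range k).erase B.1,
        (if (lo i : ℤ) - c * i + (if B.1 < i then 1 else 0) ≤ diagIdx c B + 1
          then (1 : ℤ) else 0) -
      ∑ p ∈ labelPairs (fun x : {x // x ∈ S} => x.1.1) φ, ∑ i ∈ (range k).erase p.1,
        (if ((hi i : ℤ) - colCount (labelPairs (fun x : {x // x ∈ S} => x.1.1) φ) i p.2) - c * i +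
          (if p.1 < i then 1 else 0) ≤
          ((hi p.1 : ℤ) - colCount (labelPairs (fun x : {x // x ∈ S} => x.1.1) φ) p.1 p.2) -
            c * p.1 then (1 : ℤ) else 0) := by
  set I := labelPairs (fun x : {x // x ∈ S} => x.1.1) φ with hI
  have hle : ∀ (A : {x // x ∈ S}) (ℓ : Fin m),
      ℓ ≤ φ A ↔ (A.1.2 : ℤ) < (hi A.1.1 : ℤ) - colCount I A.1.1 ℓ := fun A ℓ => by
    rw [← not_lt, hφ.lt_label_iff strip_ext_down]
    have := rank_down hS A
    change ¬ _ < colCount I A.1.1 ℓ ↔ _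
    omega
  have heq : ∀ B : {x // x ∈ S}, (hi B.1.1 : ℤ) - colCount I B.1.1 (φ B) = B.1.2 + 1 := fun B => by
    have h1 := hφ.card_label_lt strip_ext_down B
    have h2 := rank_down hS B
    change colCount I B.1.1 (φ B) = _ at h1
    omega
  rw [← sum_coe_sort S, hI, hφ.sum_labelPairs strip_ext_down, ← hI,
    ← sum_sub_distrib, card_filter, Nat.cast_sum, ← univ_product_univ, sum_product]
  refine sum_congr rfl fun B _ => ?_
  have h1 := card_attack_from hS c B.1 (fun i => (hi i : ℤ) - colCount I i (φ B))
    (fun i hi' => by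
      have h2 : colCount I i (φ B) ≤ _ := colCount_le hS strip_ext_down hφ hi' (φ B)
      have := hlo i hi'
      omega) (fun i _ => by simp)
  rw [← sum_sub_distrib]
  dsimp only at h1 ⊢
  rw [heq B, show (B.1.2 : ℤ) + 1 - c * B.1.1 = diagIdx c B.1 + 1 by rw [diagIdx]; ring]
  refine Eq.trans ?_ h1
  rw [card_filter, ← sum_coe_sort S, Nat.cast_sum]
  refine sum_congr rfl fun A _ => ?_
  congr 1
  exact if_congr (and_congr_right' (hle A _)) rfl rfl

end StripLabelings

theorem sum_ite_pairs (k : ℕ) (x : ℕ → ℤ) :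
    ∑ j ∈ range k, ∑ i ∈ (range k).erase j,
      (if x i + (if j < i then 1 else 0) ≤ x j then (1 : ℤ) else 0) = ∑ j ∈ range k, (j : ℤ) := by
  rw [sum_congr rfl fun j hj => sum_erase_range (mem_range.1 hj) _, sum_add_distrib,
    sum_Ico_triangle_comm, ← sum_add_distrib]
  refine sum_congr rfl fun j _ => ?_
  rw [← sum_add_distrib]
  calc _ = ∑ i ∈ range j, (1 : ℤ) := sum_congr rfl fun i hi => by
        have := mem_range.1 hi
        rw [if_neg (not_lt.2 this.le), if_pos this]
        split_ifs <;> omega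
    _ = _ := by simp

theorem colCount_add_colCount_compl {k m : ℕ} {I J : Finset (ℕ × Fin m)}
    (hI : I ⊆ range k ×ˢ univ) (hJ : J = (range k ×ˢ univ) \ I) {i : ℕ} (hi : i < k) (ℓ : Fin m) :
    colCount I i ℓ + colCount J i ℓ = ℓ := by
  rw [colCount, colCount, hJ, ← card_union_of_disjoint, ← filter_union, union_sdiff_of_subset hI]
  · rw [← Fin.card_Iio ℓ]
    refine card_bij (fun p _ => p.2) ?_ ?_ ?_
    · intro p hp
      simp only [mem_filter] at hp
      exact mem_Iio.2 hp.2.2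
    · intro p hp q hq h
      simp only [mem_filter] at hp hq
      exact Prod.ext (hp.2.1.trans hq.2.1.symm) h
    · intro l hl
      exact ⟨(i, l), by simpa [hi] using hl, rfl⟩
  · exact disjoint_filter_filter disjoint_sdiff

/-- The boxes below the big boxes that complete the column of big boxes to `n - k` boxes. -/
def skipBoxes (n k : ℕ) (H b : ℕ → ℕ) : Finset (ℕ × ℕ) :=
  (range k ×ˢ range (k * (n - k + 1))).filter fun B =>
    H (B.1 + 1) - (n - k) ≤ B.2 ∧ B.2 < H (B.1 + 1) - b B.1

section Boxes

variable {n k : ℕ} {H b : ℕ → ℕ}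

theorem IsDyck.lt_of_lt {K : ℕ} (hD : IsDyck K k H) {i y : ℕ} (hi : i < k) (hy : y < H (i + 1)) :
    y < K := by
  have h1 := hD.2.1 (show i + 1 ≤ k from hi)
  rw [hD.2.2.1 k le_rfl] at h1
  omega

theorem mem_boxesD_iff {K : ℕ} (hD : IsDyck K k H) (B : ℕ × ℕ) :
    B ∈ boxesD K k H ↔ B.1 < k ∧ H B.1 ≤ B.2 ∧ B.2 < H (B.1 + 1) := by
  simp only [boxesD, mem_filter, mem_product, mem_range]
  exact ⟨fun h => ⟨h.1.1, h.2⟩, fun h => ⟨⟨h.1, hD.lt_of_lt h.1 h.2.2⟩, h.2⟩⟩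

theorem mem_smallBoxes_iff {K : ℕ} (hD : IsDyck K k H) (B : ℕ × ℕ) :
    B ∈ smallBoxes K k H b ↔ B.1 < k ∧ H B.1 ≤ B.2 ∧ B.2 < H (B.1 + 1) - b B.1 := by
  simp only [smallBoxes, mem_filter, mem_product, mem_range]
  exact ⟨fun h => ⟨h.1.1, h.2⟩, fun h => ⟨⟨h.1, hD.lt_of_lt h.1 (by omega)⟩, h.2⟩⟩

theorem mem_skipBoxes_iff (hD : IsDyck (k * (n - k + 1)) k H) (B : ℕ × ℕ) :
    B ∈ skipBoxes n k H b ↔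
      B.1 < k ∧ H (B.1 + 1) - (n - k) ≤ B.2 ∧ B.2 < H (B.1 + 1) - b B.1 := by
  simp only [skipBoxes, mem_filter, mem_product, mem_range]
  exact ⟨fun h => ⟨h.1.1, h.2⟩, fun h => ⟨⟨h.1, hD.lt_of_lt h.1 (by omega)⟩, h.2⟩⟩

theorem IsBigTuple.add_le (hb : IsBigTuple n k H b) (hmono : Monotone H) {i : ℕ} (hi : i < k) :
    b i + H i ≤ H (i + 1) := by
  have := hb.1 i hi
  have := hmono (Nat.le_add_right i 1)
  omega

theorem IsDyck.sub_le (hk : 1 ≤ k) (hD : IsDyck (k * (n - k + 1)) k H) {i : ℕ} (hi : i < k) :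
    n - k ≤ H (i + 1) := by
  have h := hD.2.2.2 (i + 1) hi
  rw [mul_assoc] at h
  have := Nat.le_of_mul_le_mul_left h hk
  rw [mul_add] at this
  omega

theorem mem_bigBoxes_iff {K : ℕ} (hD : IsDyck K k H) (hb : IsBigTuple n k H b) (B : ℕ × ℕ) :
    B ∈ bigBoxes K k H b ↔ B.1 < k ∧ H (B.1 + 1) - b B.1 ≤ B.2 ∧ B.2 < H (B.1 + 1) := by
  simp only [bigBoxes, mem_filter, mem_product, mem_range]
  refine ⟨fun h => ⟨h.1.1, h.2.2⟩, fun h => ⟨⟨h.1, hD.lt_of_lt h.1 h.2.2⟩, ?_, h.2⟩⟩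
  have := hb.add_le hD.2.1 h.1
  omega

theorem card_attackPairsOn_boxesD {K c : ℕ} (hD : IsDyck K k H) (hb : IsBigTuple n k H b) :
    #(attackPairsOn c (boxesD K k H)) =
      ∑ B ∈ smallBoxes K k H b, #{A ∈ boxesD K k H | Attack c A B} +
        #{p ∈ smallBoxes K k H b ×ˢ bigBoxes K k H b | Attack c p.1 p.2} +
        #{p : {x // x ∈ bigBoxes K k H b} × {x // x ∈ bigBoxes K k H b} |
          Attack c p.1.1 p.2.1} := by
  have hunion : boxesD K k H = smallBoxes K k H b ∪ bigBoxes K k H b := by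
    ext B
    rw [mem_union, mem_boxesD_iff hD, mem_smallBoxes_iff hD, mem_bigBoxes_iff hD hb]
    by_cases h : B.1 < k
    · have := hb.add_le hD.2.1 h
      omega
    · tauto
  have hdisj : Disjoint (smallBoxes K k H b) (bigBoxes K k H b) := by
    rw [disjoint_left]
    intro B h1 h2
    rw [mem_smallBoxes_iff hD] at h1
    rw [mem_bigBoxes_iff hD hb] at h2
    omega
  have hbig : #{p : {x // x ∈ bigBoxes K k H b} × {x // x ∈ bigBoxes K k H b} |
      Attack c p.1.1 p.2.1} = ∑ B ∈ bigBoxes K k H b, ∑ A ∈ bigBoxes K k H b,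
        if Attack c A B then 1 else 0 := by
    rw [card_filter, ← univ_product_univ, sum_product_right, ← sum_coe_sort (bigBoxes K k H b)]
    exact sum_congr rfl fun B _ =>
      sum_coe_sort (bigBoxes K k H b) fun A => if Attack c A B.1 then 1 else 0
  rw [hbig]
  simp only [attackPairsOn, card_filter]
  rw [sum_product_right, sum_product_right, add_assoc, ← sum_add_distrib]
  conv_lhs => rw [hunion, sum_union hdisj]
  rw [← hunion]
  congr 1
  refine sum_congr rfl fun B _ => ?_
  rw [hunion, sum_union hdisj]

/-- Comparison of the attack statistics of a labeling of the big boxes and of the complementary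
labeling of the skipped boxes. -/
theorem tdinvBigF_add_card (hk : 1 ≤ k) (hD : IsDyck (k * (n - k + 1)) k H)
    (hb : IsBigTuple n k H b) (hadm : AdmissibleB n k b) {f : BigBox n k H b → Fin (n - k)}
    {τ : {x // x ∈ skipBoxes n k H b} → Fin (n - k)}
    (hf : ColInc (fun x : BigBox n k H b => x.1.1) (fun x => (x.1.2 : ℤ)) f)
    (hτ : ColInc (fun x : {x // x ∈ skipBoxes n k H b} => x.1.1) (fun x => -(x.1.2 : ℤ)) τ)
    (hc : labelPairs (fun x : {x // x ∈ skipBoxes n k H b} => x.1.1) τ =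
      (range k ×ˢ univ) \ labelPairs (fun x : BigBox n k H b => x.1.1) f) :
    tdinvBigF n k H b f + #{p : {x // x ∈ skipBoxes n k H b} × {x // x ∈ skipBoxes n k H b} |
        Attack (n - k + 1) p.1.1 p.2.1} =
      #{p : {x // x ∈ skipBoxes n k H b} × {x // x ∈ skipBoxes n k H b} |
        Attack (n - k + 1) p.1.1 p.2.1 ∧ τ p.2 < τ p.1} +
      (maxtdinvD (n - k + 1) (k * (n - k + 1)) k H - pathdinvD (k * (n - k + 1)) k H -
        #{p ∈ smallBoxes (k * (n - k + 1)) k H b ×ˢ bigBoxes (k * (n - k + 1)) k H b |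
          Attack (n - k + 1) p.1 p.2}) := by
  have hmono := hD.2.1
  have hbig := mem_bigBoxes_iff hD hb
  have hskip := mem_skipBoxes_iff (b := b) hD
  have hI : labelPairs (fun x : BigBox n k H b => x.1.1) f ⊆ range k ×ˢ univ := by
    intro p hp
    obtain ⟨x, hx, -⟩ := mem_labelPairs.1 hp
    rw [mem_product, mem_range, ← hx]
    exact ⟨((hbig _).1 x.2).1, mem_univ _⟩
  have e1 := card_nonInversions_up (lo := fun i => H (i + 1) - b i) (hi := fun i => H (i + 1))
    hbig (fun i _ => Nat.sub_le _ _) hf (n - k + 1)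
  have e2 := card_nonInversions_down (lo := fun i => H (i + 1) - (n - k))
    (hi := fun i => H (i + 1) - b i) hskip
    (fun i hi => Nat.sub_le_sub_left (hadm i hi) _) hτ (n - k + 1)
  set I := labelPairs (fun x : BigBox n k H b => x.1.1) f with hIdef
  set J := labelPairs (fun x : {x // x ∈ skipBoxes n k H b} => x.1.1) τ with hJdef
  rw [sum_strip (lo := fun i => H (i + 1) - b i) (hi := fun i => H (i + 1)) hbig] at e1
  rw [sum_strip (lo := fun i => H (i + 1) - (n - k)) (hi := fun i => H (i + 1) - b i) hskip] at e2
  have e3 := pathdinvD_add_sums hk hD hb hadm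
  have e4 : (∑ B ∈ smallBoxes (k * (n - k + 1)) k H b,
      #{A ∈ boxesD (k * (n - k + 1)) k H | Attack (n - k + 1) A B} : ℤ) =
      ∑ B ∈ smallBoxes (k * (n - k + 1)) k H b, ∑ i ∈ (range k).erase B.1,
        ((if (H i : ℤ) - (n - k + 1 : ℕ) * i + (if B.1 < i then 1 else 0) ≤
          diagIdx (n - k + 1) B then 1 else 0) -
        if (H (i + 1) : ℤ) - (n - k + 1 : ℕ) * i + (if B.1 < i then 1 else 0) ≤
          diagIdx (n - k + 1) B then 1 else 0) := by
    refine sum_congr rfl fun B _ => ?_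
    rw [← card_attack_to (mem_boxesD_iff hD) (n - k + 1) B (fun i => (H i : ℤ)) (fun i _ => le_rfl)
      (fun i _ => by exact_mod_cast hmono (Nat.le_add_right i 1))]
    congr 2
    refine filter_congr fun A hA => ?_
    rw [mem_boxesD_iff hD] at hA
    simp [hA.2.1]
  have e5 := card_attackPairsOn_boxesD (c := n - k + 1) hD hb
  rw [← maxtdinvD_eq] at e5
  have e6 : tdinvBigF n k H b f + #{p : BigBox n k H b × BigBox n k H b |
      Attack (n - k + 1) p.1.1 p.2.1 ∧ f p.2 ≤ f p.1} =
      #{p : BigBox n k H b × BigBox n k H b | Attack (n - k + 1) p.1.1 p.2.1} := by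
    rw [tdinvBigF, univ_product_univ,
      ← card_filter_add_card_filter_not (s := {p : BigBox n k H b × BigBox n k H b |
        Attack (n - k + 1) p.1.1 p.2.1}) (fun p => f p.1 < f p.2), filter_filter, filter_filter]
    simp only [not_lt]
  have e7 : #{p : {x // x ∈ skipBoxes n k H b} × {x // x ∈ skipBoxes n k H b} |
        Attack (n - k + 1) p.1.1 p.2.1 ∧ τ p.2 < τ p.1} +
      #{p : {x // x ∈ skipBoxes n k H b} × {x // x ∈ skipBoxes n k H b} |
        Attack (n - k + 1) p.1.1 p.2.1 ∧ τ p.1 ≤ τ p.2} =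
      #{p : {x // x ∈ skipBoxes n k H b} × {x // x ∈ skipBoxes n k H b} |
        Attack (n - k + 1) p.1.1 p.2.1} := by
    rw [← card_filter_add_card_filter_not
      (s := {p : {x // x ∈ skipBoxes n k H b} × {x // x ∈ skipBoxes n k H b} |
        Attack (n - k + 1) p.1.1 p.2.1}) (fun p => τ p.2 < τ p.1), filter_filter, filter_filter]
    simp only [not_lt]
  have e8 : ∑ p ∈ I, ∑ i ∈ (range k).erase p.1,
      (if ((H (i + 1) - b i : ℕ) : ℤ) + colCount I i p.2 - (n - k + 1 : ℕ) * i +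
        (if p.1 < i then 1 else 0) ≤
        ((H (p.1 + 1) - b p.1 : ℕ) : ℤ) + colCount I p.1 p.2 - (n - k + 1 : ℕ) * p.1
          then (1 : ℤ) else 0) +
      ∑ p ∈ J, ∑ i ∈ (range k).erase p.1,
      (if ((H (i + 1) - b i : ℕ) : ℤ) - colCount J i p.2 - (n - k + 1 : ℕ) * i +
        (if p.1 < i then 1 else 0) ≤
        ((H (p.1 + 1) - b p.1 : ℕ) : ℤ) - colCount J p.1 p.2 - (n - k + 1 : ℕ) * p.1
          then (1 : ℤ) else 0) = (n - k : ℕ) * ∑ j ∈ range k, (j : ℤ) := by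
    have hcount : ∀ i, i < k → ∀ ℓ : Fin (n - k), (colCount I i ℓ : ℤ) = ℓ - colCount J i ℓ :=
      fun i hi ℓ => by
        have := colCount_add_colCount_compl hI hc hi ℓ
        omega
    have hIJ : ∑ p ∈ I, ∑ i ∈ (range k).erase p.1,
        (if ((H (i + 1) - b i : ℕ) : ℤ) + colCount I i p.2 - (n - k + 1 : ℕ) * i +
          (if p.1 < i then 1 else 0) ≤
          ((H (p.1 + 1) - b p.1 : ℕ) : ℤ) + colCount I p.1 p.2 - (n - k + 1 : ℕ) * p.1
            then (1 : ℤ) else 0) =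
        ∑ p ∈ I, ∑ i ∈ (range k).erase p.1,
        (if ((H (i + 1) - b i : ℕ) : ℤ) - colCount J i p.2 - (n - k + 1 : ℕ) * i +
          (if p.1 < i then 1 else 0) ≤
          ((H (p.1 + 1) - b p.1 : ℕ) : ℤ) - colCount J p.1 p.2 - (n - k + 1 : ℕ) * p.1
            then (1 : ℤ) else 0) := by
      refine sum_congr rfl fun p hp => sum_congr rfl fun i hi => ?_
      have h1 := hcount p.1 (mem_range.1 (mem_product.1 (hI hp)).1) p.2
      have h2 := hcount i (mem_range.1 (mem_of_mem_erase hi)) p.2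
      rw [h1, h2]
      refine if_congr ?_ rfl rfl
      constructor <;> intro h <;> linarith
    rw [hIJ, hc, add_comm, sum_sdiff hI, sum_product_right]
    simp only [sum_ite_pairs k fun i => ((H (i + 1) - b i : ℕ) : ℤ) -
      colCount ((range k ×ˢ univ) \ I) i _ - (n - k + 1 : ℕ) * i]
    simp
  have e9 : ∀ F : ℕ × ℕ → ℤ, ∑ j ∈ range k, ∑ y ∈ Ico (H j) (H (j + 1)), F (j, y) =
      ∑ j ∈ range k, ∑ y ∈ Ico (H j) (H (j + 1) - b j), F (j, y) +
      ∑ j ∈ range k, ∑ y ∈ Ico (H (j + 1) - b j) (H (j + 1)), F (j, y) := fun F => by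
    rw [← sum_add_distrib]
    refine sum_congr rfl fun j hj => (sum_Ico_consecutive _ ?_ (Nat.sub_le _ _)).symm
    have := hb.add_le hmono (mem_range.1 hj)
    omega
  have e10 := e9 fun B => ∑ i ∈ (range k).erase B.1,
    (if (H (i + 1) : ℤ) - (n - k + 1 : ℕ) * i + (if B.1 < i then 1 else 0) ≤
      diagIdx (n - k + 1) B then (1 : ℤ) else 0)
  have e11 := sum_strip (M := ℤ) (lo := H) (hi := fun i => H (i + 1) - b i)
    (mem_smallBoxes_iff (b := b) hD)
  simp only [sum_sub_distrib] at e4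
  zify at e5 e6 e7
  rw [e11, e11, e11] at e4
  rw [e11] at e5
  dsimp only at e1 e2 e4 e5 e10
  have e12 : (tdinvBigF n k H b f : ℤ) +
      #{p : {x // x ∈ skipBoxes n k H b} × {x // x ∈ skipBoxes n k H b} |
        Attack (n - k + 1) p.1.1 p.2.1} + pathdinvD (k * (n - k + 1)) k H +
      #{p ∈ smallBoxes (k * (n - k + 1)) k H b ×ˢ bigBoxes (k * (n - k + 1)) k H b |
          Attack (n - k + 1) p.1 p.2} =
      #{p : {x // x ∈ skipBoxes n k H b} × {x // x ∈ skipBoxes n k H b} |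
        Attack (n - k + 1) p.1.1 p.2.1 ∧ τ p.2 < τ p.1} +
      maxtdinvD (n - k + 1) (k * (n - k + 1)) k H := by
    linarith
  omega

end Boxes

theorem sum_signed_packed_of_key {R : Type*} [Fintype R] [DecidableEq R] {m : ℕ} (key : R → ℤ)
    (hkey : Function.Injective key) (hR : Fintype.card R = m) (E A : R → R → Prop)
    (hE : ∀ u v, E u v → key u < key v) (hA : ∀ u v, A u v → key u < key v) :
    ∑ τ ∈ univ.filter (fun τ : R → Fin m =>
        (∀ u, #{v | τ v < τ u} = (τ u : ℕ)) ∧ ∀ u v, E u v → τ v < τ u),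
      (-1 : Polynomial ℤ) ^ #{ℓ | ∀ u, τ u ≠ ℓ} *
        Polynomial.X ^ #{p : R × R | A p.1 p.2 ∧ τ p.2 < τ p.1} =
    Polynomial.X ^ #{p : R × R | A p.1 p.2} := by
  let _ := LinearOrder.lift' key hkey
  convert sum_signed_packed hR E A hE hA

theorem card_filter_add_card_filter_sdiff {T : Type*} [DecidableEq T] {I U : Finset T} (hI : I ⊆ U)
    (P : T → Prop) [DecidablePred P] :
    #{p ∈ I | P p} + #{p ∈ U \ I | P p} = #{p ∈ U | P p} := by
  rw [← card_union_of_disjoint (disjoint_filter_filter disjoint_sdiff), ← filter_union,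
    union_sdiff_of_subset hI]

section Complement

variable {n k : ℕ} {H b : ℕ → ℕ}

theorem labelPairs_subset {S : Finset (ℕ × ℕ)} {m : ℕ} (hS : ∀ B ∈ S, B.1 < k)
    (φ : {x // x ∈ S} → Fin m) :
    labelPairs (fun x : {x // x ∈ S} => x.1.1) φ ⊆ range k ×ˢ univ := by
  intro p hp
  obtain ⟨x, hx, -⟩ := mem_labelPairs.1 hp
  rw [mem_product, mem_range, ← hx]
  exact ⟨hS _ x.2, mem_univ _⟩

theorem card_column_product {k m : ℕ} (i : ℕ) :
    #{p ∈ range k ×ˢ (univ : Finset (Fin m)) | p.1 = i} = if i < k then m else 0 := by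
  rw [filter_product_left (fun j => j = i), card_product, card_fin, filter_eq']
  split_ifs <;> simp_all

theorem card_row_product {k m : ℕ} (ℓ : Fin m) :
    #{p ∈ range k ×ˢ (univ : Finset (Fin m)) | p.2 = ℓ} = k := by
  rw [filter_product_right (fun j => j = ℓ), card_product, card_range, filter_eq']
  simp

theorem card_bigBoxes_column (hD : IsDyck (k * (n - k + 1)) k H) (hb : IsBigTuple n k H b)
    (i : ℕ) : #{x : BigBox n k H b | x.1.1 = i} = b i := by
  rw [card_column_eq (lo := fun i => H (i + 1) - b i) (hi := fun i => H (i + 1))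
    (mem_bigBoxes_iff hD hb)]
  split_ifs with h
  · have := hb.add_le hD.2.1 h
    omega
  · rw [hb.2.2 i (not_lt.1 h)]

theorem card_skipBoxes_column (hk : 1 ≤ k) (hD : IsDyck (k * (n - k + 1)) k H)
    (hb : IsBigTuple n k H b) (i : ℕ) :
    #{x : {x // x ∈ skipBoxes n k H b} | x.1.1 = i} = if i < k then n - k - b i else 0 := by
  rw [card_column_eq (lo := fun i => H (i + 1) - (n - k)) (hi := fun i => H (i + 1) - b i)
    (mem_skipBoxes_iff hD)]
  split_ifs with h
  · have := hb.add_le hD.2.1 h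
    have := hD.sub_le hk h
    omega
  · rfl

theorem card_skipBoxes (hk : 1 ≤ k) (hnk : k < n) (hD : IsDyck (k * (n - k + 1)) k H)
    (hb : IsBigTuple n k H b) (hadm : AdmissibleB n k b) :
    Fintype.card {x // x ∈ skipBoxes n k H b} = n - k := by
  rw [Fintype.card_coe, card_eq_sum_ones,
    sum_strip (lo := fun i => H (i + 1) - (n - k)) (hi := fun i => H (i + 1) - b i)
      (mem_skipBoxes_iff hD)]
  simp only [sum_const, Nat.card_Ico, smul_eq_mul, mul_one]
  have h1 : ∑ j ∈ range k, (H (j + 1) - b j - (H (j + 1) - (n - k))) + ∑ j ∈ range k, b j =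
      k * (n - k) := by
    rw [← sum_add_distrib, sum_congr rfl (g := fun _ => n - k)]
    · simp
    · intro j hj
      rw [mem_range] at hj
      have := hadm j hj
      have := hb.add_le hD.2.1 hj
      have := hD.sub_le hk hj
      omega
  rw [hb.2.1, mul_add] at h1
  have : n - k ≤ k * (n - k) := Nat.le_mul_of_pos_left _ hk
  omega

theorem exists_complement (hk : 1 ≤ k) (hD : IsDyck (k * (n - k + 1)) k H)
    (hb : IsBigTuple n k H b) {f : BigBox n k H b → Fin (n - k)}
    (hf : ColInc (fun x : BigBox n k H b => x.1.1) (fun x => (x.1.2 : ℤ)) f) :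
    ∃ τ : {x // x ∈ skipBoxes n k H b} → Fin (n - k),
      ColInc (fun x : {x // x ∈ skipBoxes n k H b} => x.1.1) (fun x => -(x.1.2 : ℤ)) τ ∧
      labelPairs (fun x : {x // x ∈ skipBoxes n k H b} => x.1.1) τ =
        (range k ×ˢ univ) \ labelPairs (fun x : BigBox n k H b => x.1.1) f := by
  refine exists_colInc strip_ext_down _ fun i => ?_
  have h1 := card_filter_add_card_filter_sdiff (I := labelPairs (fun x : BigBox n k H b => x.1.1) f)
    (labelPairs_subset (fun B hB => ((mem_bigBoxes_iff hD hb B).1 hB).1) f) fun p => p.1 = i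
  rw [← hf.card_filter strip_ext_up fun p => p.1 = i, card_bigBoxes_column hD hb,
    card_column_product] at h1
  rw [card_skipBoxes_column hk hD hb]
  split_ifs at h1 ⊢ <;> omega

theorem exists_complement' (hk : 1 ≤ k) (hD : IsDyck (k * (n - k + 1)) k H)
    (hb : IsBigTuple n k H b) (hadm : AdmissibleB n k b)
    {τ : {x // x ∈ skipBoxes n k H b} → Fin (n - k)}
    (hτ : ColInc (fun x : {x // x ∈ skipBoxes n k H b} => x.1.1) (fun x => -(x.1.2 : ℤ)) τ) :
    ∃ f : BigBox n k H b → Fin (n - k),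
      ColInc (fun x : BigBox n k H b => x.1.1) (fun x => (x.1.2 : ℤ)) f ∧
      labelPairs (fun x : BigBox n k H b => x.1.1) f =
        (range k ×ˢ univ) \ labelPairs (fun x : {x // x ∈ skipBoxes n k H b} => x.1.1) τ := by
  refine exists_colInc strip_ext_up _ fun i => ?_
  have h1 := card_filter_add_card_filter_sdiff
    (labelPairs_subset (fun B hB => ((mem_skipBoxes_iff hD B).1 hB).1) τ) fun p => p.1 = i
  rw [← hτ.card_filter strip_ext_down fun p => p.1 = i, card_skipBoxes_column hk hD hb,
    card_column_product] at h1
  rw [card_bigBoxes_column hD hb]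
  split_ifs at h1 with h
  · have := hadm i h
    omega
  · rw [hb.2.2 i (not_lt.1 h)]
    omega

theorem card_label_add_card_label (hD : IsDyck (k * (n - k + 1)) k H)
    (hb : IsBigTuple n k H b) {f : BigBox n k H b → Fin (n - k)}
    {τ : {x // x ∈ skipBoxes n k H b} → Fin (n - k)}
    (hf : ColInc (fun x : BigBox n k H b => x.1.1) (fun x => (x.1.2 : ℤ)) f)
    (hτ : ColInc (fun x : {x // x ∈ skipBoxes n k H b} => x.1.1) (fun x => -(x.1.2 : ℤ)) τ)
    (hc : labelPairs (fun x : {x // x ∈ skipBoxes n k H b} => x.1.1) τ =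
      (range k ×ˢ univ) \ labelPairs (fun x : BigBox n k H b => x.1.1) f) (ℓ : Fin (n - k)) :
    #{B | f B = ℓ} + #{u | τ u = ℓ} = k := by
  have h1 := card_filter_add_card_filter_sdiff
    (labelPairs_subset (fun B hB => ((mem_bigBoxes_iff hD hb B).1 hB).1) f) fun p => p.2 = ℓ
  rw [← hc, ← hf.card_filter strip_ext_up fun p => p.2 = ℓ,
    ← hτ.card_filter strip_ext_down fun p => p.2 = ℓ, card_row_product] at h1
  exact h1

/-- For a fixed labeling, only the content complementary to its own contributes. -/
theorem sum_contents (hk : 1 ≤ k) (hnk : k < n) (hD : IsDyck (k * (n - k + 1)) k H)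
    (hb : IsBigTuple n k H b) (hadm : AdmissibleB n k b) {f : BigBox n k H b → Fin (n - k)}
    {τ : {x // x ∈ skipBoxes n k H b} → Fin (n - k)}
    (hf : ColInc (fun x : BigBox n k H b => x.1.1) (fun x => (x.1.2 : ℤ)) f)
    (hτ : ColInc (fun x : {x // x ∈ skipBoxes n k H b} => x.1.1) (fun x => -(x.1.2 : ℤ)) τ)
    (hc : labelPairs (fun x : {x // x ∈ skipBoxes n k H b} => x.1.1) τ =
      (range k ×ˢ univ) \ labelPairs (fun x : BigBox n k H b => x.1.1) f) :
    ∑ α ∈ univ.filter (fun α : Fin (n - k) → Fin (n - k + 1) =>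
        AllowableContent (n - k) (fun i => (α i : ℕ)) ∧ HasContent n k H b α f),
      (-1 : Polynomial ℤ) ^ #{i | (α i : ℕ) = 0} =
    if ∀ u, #{v | τ v < τ u} = (τ u : ℕ) then (-1) ^ #{ℓ | ∀ u, τ u ≠ ℓ} else 0 := by
  have hR := card_skipBoxes hk hnk hD hb hadm
  let α₀ : Fin (n - k) → Fin (n - k + 1) := fun ℓ => ⟨#{u | τ u = ℓ}, by
    have := card_filter_le univ fun u => τ u = ℓ
    rw [card_univ, hR] at this
    omega⟩
  have hα : ∀ α : Fin (n - k) → Fin (n - k + 1), HasContent n k H b α f ↔ α = α₀ := fun α => by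
    rw [HasContent, funext_iff]
    refine forall_congr' fun ℓ => ?_
    have := card_label_add_card_label hD hb hf hτ hc ℓ
    rw [Fin.ext_iff]
    change _ ↔ (α ℓ : ℕ) = #{u | τ u = ℓ}
    omega
  have hz : #{i | (α₀ i : ℕ) = 0} = #{ℓ | ∀ u, τ u ≠ ℓ} := by
    congr 1
    ext ℓ
    simp only [mem_filter, mem_univ, true_and, α₀, card_eq_zero, filter_eq_empty_iff]
    simp
  simp only [hα]
  split_ifs with hp
  · rw [← hz, show univ.filter (fun α : Fin (n - k) → Fin (n - k + 1) =>
      AllowableContent (n - k) (fun i => (α i : ℕ)) ∧ α = α₀) = {α₀} from ?_, sum_singleton]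
    ext α
    simp only [mem_filter, mem_univ, true_and, mem_singleton]
    refine ⟨And.right, ?_⟩
    rintro rfl
    exact ⟨(allowableContent_card_fiber_iff hR τ).2 hp, rfl⟩
  · rw [filter_false_of_mem, sum_empty]
    rintro α - ⟨h1, rfl⟩
    exact hp ((allowableContent_card_fiber_iff hR τ).1 h1)

theorem colInc_iff_colStrict {f : BigBox n k H b → Fin (n - k)} :
    ColInc (fun x : BigBox n k H b => x.1.1) (fun x => (x.1.2 : ℤ)) f ↔ ColStrict n k H b f := by
  simp only [ColInc, ColStrict, Nat.cast_lt]

theorem ColStrict.admissible (hD : IsDyck (k * (n - k + 1)) k H) (hb : IsBigTuple n k H b)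
    {f : BigBox n k H b → Fin (n - k)} (hf : ColStrict n k H b f) : AdmissibleB n k b := by
  intro i _
  have h1 := card_le_card_of_injOn f (s := {x : BigBox n k H b | x.1.1 = i}) (t := univ)
    (fun _ _ => mem_univ _) (by
      intro x hx y hy hxy
      simp only [coe_filter, mem_univ, true_and, Set.mem_ofPred_eq] at hx hy
      rcases lt_trichotomy x.1.2 y.1.2 with h | h | h
      · exact absurd hxy (hf x y (hx.trans hy.symm) h).ne
      · exact Subtype.ext (Prod.ext (hx.trans hy.symm) h)
      · exact absurd hxy (hf y x (hy.trans hx.symm) h).ne')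
  rwa [card_bigBoxes_column hD hb, card_fin] at h1

/-- Complementation of the label sets is a bijection between the column-strict labelings of the big
boxes and the column-decreasing labelings of the skipped boxes. -/
theorem sum_colStrict_eq {M : Type*} [AddCommMonoid M] (hk : 1 ≤ k)
    (hD : IsDyck (k * (n - k + 1)) k H) (hb : IsBigTuple n k H b) (hadm : AdmissibleB n k b)
    (F : (BigBox n k H b → Fin (n - k)) → M)
    (G : ({x // x ∈ skipBoxes n k H b} → Fin (n - k)) → M)
    (hFG : ∀ f τ, ColInc (fun x : BigBox n k H b => x.1.1) (fun x => (x.1.2 : ℤ)) f →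
      ColInc (fun x : {x // x ∈ skipBoxes n k H b} => x.1.1) (fun x => -(x.1.2 : ℤ)) τ →
      labelPairs (fun x : {x // x ∈ skipBoxes n k H b} => x.1.1) τ =
        (range k ×ˢ univ) \ labelPairs (fun x : BigBox n k H b => x.1.1) f → F f = G τ) :
    ∑ f ∈ univ.filter (ColStrict n k H b), F f =
      ∑ τ ∈ univ.filter (fun τ : {x // x ∈ skipBoxes n k H b} → Fin (n - k) =>
        ColInc (fun x => x.1.1) (fun x => -(x.1.2 : ℤ)) τ), G τ := by
  have hex := fun (f : BigBox n k H b → Fin (n - k)) (hf : f ∈ univ.filter (ColStrict n k H b)) =>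
    exists_complement hk hD hb (colInc_iff_colStrict.2 (mem_filter.1 hf).2)
  have hsub : ∀ f : BigBox n k H b → Fin (n - k),
      labelPairs (fun x : BigBox n k H b => x.1.1) f ⊆ range k ×ˢ univ := fun f =>
    labelPairs_subset (fun B hB => ((mem_bigBoxes_iff hD hb B).1 hB).1) f
  choose T hT1 hT2 using hex
  refine sum_bij T (fun f hf => mem_filter.2 ⟨mem_univ _, hT1 f hf⟩) (fun f hf g hg hfg => ?_)
    (fun τ hτ => ?_) fun f hf =>
      hFG f _ (colInc_iff_colStrict.2 (mem_filter.1 hf).2) (hT1 f hf) (hT2 f hf)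
  · refine (colInc_iff_colStrict.2 (mem_filter.1 hf).2).eq_of_labelPairs_eq strip_ext_up
      (colInc_iff_colStrict.2 (mem_filter.1 hg).2) ?_
    have h := (hT2 f hf).symm.trans ((congrArg _ hfg).trans (hT2 g hg))
    rw [← Finset.sdiff_sdiff_eq_self (hsub f), h, Finset.sdiff_sdiff_eq_self (hsub g)]
  · have hτ' := (mem_filter.1 hτ).2
    obtain ⟨f, hf, hfτ⟩ := exists_complement' hk hD hb hadm hτ'
    have hf' : f ∈ univ.filter (ColStrict n k H b) :=
      mem_filter.2 ⟨mem_univ _, colInc_iff_colStrict.1 hf⟩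
    refine ⟨f, hf', (hT1 f hf').eq_of_labelPairs_eq strip_ext_down hτ' ?_⟩
    rw [hT2 f hf', hfτ, Finset.sdiff_sdiff_eq_self
      (labelPairs_subset (fun B hB => ((mem_skipBoxes_iff hD B).1 hB).1) τ)]

/-- The signed sum over packed column-decreasing labelings of the skipped boxes. -/
theorem sum_signed_packed_skipBoxes (hk : 1 ≤ k) (hnk : k < n)
    (hD : IsDyck (k * (n - k + 1)) k H) (hb : IsBigTuple n k H b) (hadm : AdmissibleB n k b) :
    ∑ τ ∈ univ.filter (fun τ : {x // x ∈ skipBoxes n k H b} → Fin (n - k) =>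
        (∀ u, #{v | τ v < τ u} = (τ u : ℕ)) ∧
          ColInc (fun x => x.1.1) (fun x => -(x.1.2 : ℤ)) τ),
      (-1 : Polynomial ℤ) ^ #{ℓ | ∀ u, τ u ≠ ℓ} *
        Polynomial.X ^ #{p : {x // x ∈ skipBoxes n k H b} × {x // x ∈ skipBoxes n k H b} |
          Attack (n - k + 1) p.1.1 p.2.1 ∧ τ p.2 < τ p.1} =
    Polynomial.X ^ #{p : {x // x ∈ skipBoxes n k H b} × {x // x ∈ skipBoxes n k H b} |
      Attack (n - k + 1) p.1.1 p.2.1} := by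
  have hcol : ∀ u : {x // x ∈ skipBoxes n k H b}, u.1.1 < k := fun u =>
    ((mem_skipBoxes_iff hD u.1).1 u.2).1
  have hk' : (0 : ℤ) < k := by exact_mod_cast hk
  have hE : ∀ τ : {x // x ∈ skipBoxes n k H b} → Fin (n - k),
      ColInc (fun x => x.1.1) (fun x => -(x.1.2 : ℤ)) τ ↔
        ∀ u v, (u.1.1 = v.1.1 ∧ u.1.2 < v.1.2) → τ v < τ u := fun τ => by
    simp only [ColInc, neg_lt_neg_iff, Nat.cast_lt]
    exact ⟨fun h u v huv => h v u huv.1.symm huv.2, fun h u v h1 h2 => h v u ⟨h1.symm, h2⟩⟩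
  have hkey : Function.Injective fun u : {x // x ∈ skipBoxes n k H b} =>
      (k : ℤ) * diagIdx (n - k + 1) u.1 + u.1.1 := by
    intro u v huv
    have h1 : u.1.1 = v.1.1 := by
      have h := congrArg (· % (k : ℤ)) huv
      simp only [Int.mul_add_emod_self_left] at h
      rw [← Int.natCast_mod, ← Int.natCast_mod, Nat.mod_eq_of_lt (hcol u),
        Nat.mod_eq_of_lt (hcol v)] at h
      exact_mod_cast h
    refine strip_ext u v h1 ?_
    have h2 := mul_left_cancel₀ hk'.ne' (add_right_cancel (huv.trans (by rw [h1])))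
    rw [diagIdx, diagIdx, h1] at h2
    exact_mod_cast sub_left_injective h2
  have hlt : ∀ u v : {x // x ∈ skipBoxes n k H b}, (u.1.1 = v.1.1 ∧ u.1.2 < v.1.2) →
      (k : ℤ) * diagIdx (n - k + 1) u.1 + u.1.1 < k * diagIdx (n - k + 1) v.1 + v.1.1 := by
    rintro u v ⟨h1, h2⟩
    have h3 : diagIdx (n - k + 1) u.1 < diagIdx (n - k + 1) v.1 := by
      rw [diagIdx, diagIdx, h1]
      gcongr
    have := mul_lt_mul_of_pos_left h3 hk'
    rw [h1]
    gcongr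
  have h := sum_signed_packed_of_key _ hkey (card_skipBoxes hk hnk hD hb hadm) _
    (fun u v => Attack (n - k + 1) u.1 v.1) hlt fun u v h => key_lt_of_attack _ (hcol u) h
  simp only [hE]
  convert h

end Complement

/-- in `ℤ[q]`, the signed sum over allowable contents `α` of length
`n - k` and over column-strict labelings `P ∈ P(D, b, α)` of the big boxes of
`q ^ tdinv_big P` equals `q ^ (maxtdinv D - pathdinv D - d(s, b))` if `b` is
admissible, and `0` otherwise. -/
theorem stmt12 (n k : ℕ) (hk : 1 ≤ k) (hnk : k < n) (H b : ℕ → ℕ)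
    (hD : IsDyck (k * (n - k + 1)) k H) (hb : IsBigTuple n k H b) :
    (∑ α ∈ (Finset.univ : Finset (Fin (n - k) → Fin (n - k + 1))).filter
        (fun α => AllowableContent (n - k) fun i => (α i : ℕ)),
      (-1 : Polynomial ℤ) ^
          (((Finset.univ : Finset (Fin (n - k))).filter fun i => (α i : ℕ) = 0).card) *
        ∑ f ∈ (Finset.univ : Finset (BigBox n k H b → Fin (n - k))).filter
            (fun f => ColStrict n k H b f ∧ HasContent n k H b α f),
          Polynomial.X ^ tdinvBigF n k H b f) =
      if AdmissibleB n k b then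
        (Polynomial.X : Polynomial ℤ) ^
          (maxtdinvD (n - k + 1) (k * (n - k + 1)) k H -
            pathdinvD (k * (n - k + 1)) k H -
            ((smallBoxes (k * (n - k + 1)) k H b ×ˢ
                bigBoxes (k * (n - k + 1)) k H b).filter fun p =>
              Attack (n - k + 1) p.1 p.2).card)
      else 0 := by
  rw [show (∑ α ∈ (Finset.univ : Finset (Fin (n - k) → Fin (n - k + 1))).filter
        (fun α => AllowableContent (n - k) fun i => (α i : ℕ)),
      (-1 : Polynomial ℤ) ^
          (((Finset.univ : Finset (Fin (n - k))).filter fun i => (α i : ℕ) = 0).card) *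
        ∑ f ∈ (Finset.univ : Finset (BigBox n k H b → Fin (n - k))).filter
            (fun f => ColStrict n k H b f ∧ HasContent n k H b α f),
          Polynomial.X ^ tdinvBigF n k H b f) =
      ∑ f ∈ univ.filter (ColStrict n k H b),
        (∑ α ∈ univ.filter (fun α : Fin (n - k) → Fin (n - k + 1) =>
          AllowableContent (n - k) (fun i => (α i : ℕ)) ∧ HasContent n k H b α f),
          (-1 : Polynomial ℤ) ^ #{i | (α i : ℕ) = 0}) * Polynomial.X ^ tdinvBigF n k H b f from by
    simp only [mul_sum, sum_mul]
    refine sum_comm' fun α f => ?_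
    simp only [mem_filter, mem_univ, true_and]
    tauto]
  split_ifs with hadm
  · have hX := pow_ne_zero #{p : {x // x ∈ skipBoxes n k H b} × {x // x ∈ skipBoxes n k H b} |
      Attack (n - k + 1) p.1.1 p.2.1} (Polynomial.X_ne_zero (R := ℤ))
    refine mul_right_cancel₀ hX ?_
    conv_rhs => rw [← sum_signed_packed_skipBoxes hk hnk hD hb hadm, mul_comm, sum_mul]
    simp_rw [and_comm (b := ColInc _ _ _)]
    rw [← filter_filter, sum_filter _ (s := univ.filter _), sum_mul]
    refine sum_colStrict_eq hk hD hb hadm _ _ fun f τ hf hτ hc => ?_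
    rw [sum_contents hk hnk hD hb hadm hf hτ hc, mul_assoc, ← pow_add,
      tdinvBigF_add_card hk hD hb hadm hf hτ hc, pow_add, ← mul_assoc]
    split_ifs with hp
    · rfl
    · simp only [zero_mul]
  · refine (sum_congr (filter_false_of_mem fun f _ hf => hadm (hf.admissible hD hb))
      fun _ _ => rfl).trans sum_empty

end
end

section
/- Fix integers n > k ≥ 1. In the polynomial ring ℤ[x_1,…,x_k], let h_m denote the complete homogeneous symmetric polynomial of degree m in x_1,…,x_k (with h_0 = 1 and h_m = 0 for m < 0). Then det((h_{(n−k)−i+j})_{i,j=1}^{k−1}) = Σ_μ x_1^{μ_1} ⋯ x_k^{μ_k}, the sum over all tuples (μ_1,…,μ_k) of integers with 0 ≤ μ_i ≤ n−k for all i and μ_1 + ⋯ + μ_k = (n−k)(k−1). (The left-hand side is the Schur polynomial s_{(n−k)^{k−1}}(x_1,…,x_k) via the Jacobi–Trudi formula.) -/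
open scoped Classical

noncomputable section

/-- The complete homogeneous symmetric polynomial of degree `m` in the variables
`x_0, …, x_{k-1}` (the sum of all monomials of total degree `m`), with `h 0 = 1`
and `h m = 0` for `m < 0`. -/
def hpoly (k : ℕ) (m : ℤ) : MvPolynomial (Fin k) ℤ :=
  if 0 ≤ m then
    ∑ d ∈ (Finset.univ : Finset (Fin k → Fin (m.toNat + 1))).filter
        (fun d => ∑ i, (d i : ℕ) = m.toNat),
      ∏ i, (MvPolynomial.X i) ^ (d i : ℕ)
  else 0

/-- The generating series `∏ i, 1 / (1 - x i * t)` of the complete homogeneous sums. -/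
def completeSeries {ι A : Type*} [Fintype ι] [CommRing A] (x : ι → A) : PowerSeries A :=
  ∏ i, PowerSeries.mk fun n => x i ^ n

/-- The complete homogeneous symmetric sum of integer degree `m` in the elements `x i`. -/
def completeSum {ι A : Type*} [Fintype ι] [CommRing A] (x : ι → A) (m : ℤ) : A :=
  if 0 ≤ m then PowerSeries.coeff m.toNat (completeSeries x) else 0

/-- The monic polynomial with roots `x i`. -/
def rootPoly {ι A : Type*} [Fintype ι] [CommRing A] (x : ι → A) : Polynomial A :=
  ∏ i, (Polynomial.X - Polynomial.C (x i))

section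

variable {ι A : Type*} [Fintype ι] [CommRing A]

lemma completeSum_natCast (x : ι → A) (m : ℕ) :
    completeSum x m = PowerSeries.coeff m (completeSeries x) := by
  simp [completeSum]

lemma completeSum_of_neg (x : ι → A) {m : ℤ} (hm : m < 0) : completeSum x m = 0 := by
  simp [completeSum, hm]

lemma mk_pow_mul_one_sub (x : A) :
    (PowerSeries.mk fun n => x ^ n) * (1 - PowerSeries.C x * PowerSeries.X) = 1 := by
  have h := congrArg (PowerSeries.rescale x) (PowerSeries.mk_one_mul_one_sub_eq_one A)
  simpa [PowerSeries.rescale_mk, PowerSeries.rescale_X] using h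

lemma coeff_completeSeries [DecidableEq ι] (x : ι → A) (a : ℕ) :
    PowerSeries.coeff a (completeSeries x) =
      ∑ d ∈ (Finset.univ : Finset (ι → Fin (a + 1))).filter (fun d => ∑ i, (d i : ℕ) = a),
        ∏ i, x i ^ (d i : ℕ) := by
  rw [completeSeries, PowerSeries.coeff_prod]
  simp only [PowerSeries.coeff_mk]
  symm
  refine Finset.sum_bij (fun d _ => Finsupp.equivFunOnFinite.symm fun i => (d i : ℕ)) ?_ ?_ ?_ ?_
  · intro d hd
    simpa using hd
  · intro d _ d' _ h
    ext i
    simpa using DFunLike.congr_fun h i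
  · intro l hl
    have hsum : ∑ i, l i = a := by simpa using hl
    have hle : ∀ i, l i < a + 1 := fun i => by
      have := Finset.single_le_sum (f := l) (fun j _ => Nat.zero_le _) (Finset.mem_univ i)
      omega
    exact ⟨fun i => ⟨l i, hle i⟩, by simpa using hsum, by ext i; simp⟩
  · intro d _
    simp

lemma natDegree_rootPoly [Nontrivial A] (x : ι → A) :
    (rootPoly x).natDegree = Fintype.card ι := by
  simp [rootPoly, Polynomial.natDegree_prod_of_monic _ _ fun i _ => Polynomial.monic_X_sub_C (x i)]

lemma coeff_rootPoly_card [Nontrivial A] (x : ι → A) :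
    (rootPoly x).coeff (Fintype.card ι) = 1 := by
  rw [← natDegree_rootPoly x]
  exact Polynomial.monic_prod_of_monic _ _ fun i _ => Polynomial.monic_X_sub_C (x i)

lemma reverse_rootPoly [IsDomain A] (x : ι → A) :
    (rootPoly x).reverse = ∏ i, (1 - Polynomial.C (x i) * Polynomial.X) := by
  have hprod (s : Finset ι) : (∏ i ∈ s, (Polynomial.X - Polynomial.C (x i))).reverse =
      ∏ i ∈ s, (1 - Polynomial.C (x i) * Polynomial.X) := by
    induction s using Finset.induction_on with
    | empty => simpa using Polynomial.reverse_C (1 : A)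
    | insert i s hi ih =>
      rw [Finset.prod_insert hi, Finset.prod_insert hi, Polynomial.reverse_mul_of_domain, ih]
      congr 1
      rw [Polynomial.reverse, Polynomial.natDegree_X_sub_C, Polynomial.reflect_sub,
        Polynomial.reflect_one_X, Polynomial.reflect_C, pow_one]
  exact hprod Finset.univ

lemma completeSeries_mul_reverse_rootPoly [IsDomain A] (x : ι → A) :
    ((rootPoly x).reverse : PowerSeries A) * completeSeries x = 1 := by
  rw [reverse_rootPoly, completeSeries, ← Polynomial.coeToPowerSeries.ringHom_apply, map_prod,
    ← Finset.prod_mul_distrib]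
  refine Finset.prod_eq_one fun i _ => ?_
  rw [mul_comm]
  simpa using mk_pow_mul_one_sub (x i)

/-- The linear recurrence satisfied by the complete homogeneous sums. -/
lemma sum_coeff_rootPoly_mul_completeSum [IsDomain A] (x : ι → A) (s : ℕ) :
    ∑ j ∈ Finset.range (Fintype.card ι + 1),
      (rootPoly x).coeff j * completeSum x ((s : ℤ) - Fintype.card ι + j) =
        if s = 0 then 1 else 0 := by
  have h := congrArg (PowerSeries.coeff s) (completeSeries_mul_reverse_rootPoly x)
  rw [PowerSeries.coeff_mul, PowerSeries.coeff_one,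
    Finset.Nat.sum_antidiagonal_eq_sum_range_succ_mk] at h
  rw [← h, ← Finset.sum_range_reflect]
  set k := Fintype.card ι with hk
  have hl : ∑ r ∈ Finset.range (s + 1), PowerSeries.coeff r ((rootPoly x).reverse : PowerSeries A) *
      PowerSeries.coeff (s - r) (completeSeries x) =
      ∑ r ∈ Finset.range (s + k + 1),
        (rootPoly x).reverse.coeff r * completeSum x ((s : ℤ) - r) := by
    rw [← Finset.sum_subset (Finset.range_mono (show s + 1 ≤ s + k + 1 by omega))]
    · refine Finset.sum_congr rfl fun r hr => ?_
      have hr' : r ≤ s := by simpa [Nat.lt_succ_iff] using hr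
      rw [Polynomial.coeff_coe, ← Nat.cast_sub hr', completeSum_natCast]
    · intro r _ hr
      rw [completeSum_of_neg, mul_zero]
      simp at hr
      omega
  rw [hl, ← Finset.sum_subset (Finset.range_mono (show k + 1 ≤ s + k + 1 by omega))]
  · refine Finset.sum_congr rfl fun r hr => ?_
    have hr' : r ≤ k := by simpa [Nat.lt_succ_iff] using hr
    rw [Polynomial.coeff_reverse, natDegree_rootPoly, ← hk, Polynomial.revAt_le hr']
    have h1 : k + 1 - 1 - r = k - r := by omega
    have h2 : (s : ℤ) - k + ((k - r : ℕ) : ℤ) = s - r := by omega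
    rw [h1, h2]
  · intro r _ hr
    rw [Polynomial.coeff_reverse, natDegree_rootPoly, ← hk,
      Polynomial.revAt_eq_self_of_lt (by simpa using hr),
      Polynomial.coeff_eq_zero_of_natDegree_lt, zero_mul]
    rw [natDegree_rootPoly, ← hk]
    simpa using hr

/-- If `x i * y i = e` for all `i`, the complete homogeneous sums in `y` satisfy a recurrence
with coefficients taken from the polynomial with roots `x`. -/
lemma sum_coeff_rootPoly_mul_pow_mul_coeff (x y : ι → A) (e : A) (hxy : ∀ i, x i * y i = e)
    (a : ℕ) :
    ∑ r ∈ Finset.range (a + 2), (rootPoly x).coeff r * e ^ r *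
      PowerSeries.coeff (a + 1 - r) (completeSeries y) = 0 := by
  have h : PowerSeries.rescale e (rootPoly x : PowerSeries A) * completeSeries y =
      PowerSeries.C (∏ i, -x i) := by
    rw [rootPoly, completeSeries, ← Polynomial.coeToPowerSeries.ringHom_apply, map_prod, map_prod,
      map_prod, ← Finset.prod_mul_distrib]
    refine Finset.prod_congr rfl fun i _ => ?_
    have := mk_pow_mul_one_sub (y i)
    have hC : PowerSeries.rescale e (PowerSeries.C (x i)) = PowerSeries.C (x i) := by
      ext n
      rw [PowerSeries.coeff_rescale, PowerSeries.coeff_C]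
      split_ifs with hn <;> simp [hn]
    simp only [Polynomial.coeToPowerSeries.ringHom_apply, Polynomial.coe_X,
      Polynomial.coe_C, map_sub, PowerSeries.rescale_X, hC, map_neg]
    rw [← hxy i, map_mul]
    linear_combination (-PowerSeries.C (x i)) * this
  have h' := congrArg (PowerSeries.coeff (a + 1)) h
  rw [PowerSeries.coeff_mul, PowerSeries.coeff_C,
    Finset.Nat.sum_antidiagonal_eq_sum_range_succ_mk, if_neg (by omega)] at h'
  rw [← h']
  refine Finset.sum_congr rfl fun r _ => ?_
  rw [PowerSeries.coeff_rescale, Polynomial.coeff_coe]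
  ring

lemma coeff_zero_rootPoly (x : ι → A) : (rootPoly x).coeff 0 = (-1) ^ Fintype.card ι * ∏ i, x i := by
  simp [rootPoly, Polynomial.coeff_zero_prod, Finset.prod_neg]

end

section

variable {A : Type*} [CommRing A] {m : ℕ}

/-- The companion matrix of a monic polynomial of degree `m + 1`. -/
def companionMatrix (m : ℕ) (p : Polynomial A) : Matrix (Fin (m + 1)) (Fin (m + 1)) A :=
  Matrix.of fun i j => if j = Fin.last m then -p.coeff i else if (i : ℕ) = j + 1 then 1 else 0

lemma det_companionMatrix (p : Polynomial A) :
    (companionMatrix m p).det = (-1) ^ (m + 1) * p.coeff 0 := by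
  rw [Matrix.det_succ_row_zero, Finset.sum_eq_single (Fin.last m)]
  · have : (companionMatrix m p).submatrix Fin.succ (Fin.last m).succAbove = 1 := by
      ext i j
      simp [companionMatrix, Matrix.one_apply, Fin.ext_iff, j.2.ne]
    rw [this]
    simp [companionMatrix, pow_succ]
  · intro j _ hj
    simp [companionMatrix, hj]
  · simp

/-- The square Jacobi–Trudi matrix `(h_{a - i + j})` of size `m + 1`. -/
def jacobiTrudiMatrix (x : Fin (m + 1) → A) (a : ℕ) : Matrix (Fin (m + 1)) (Fin (m + 1)) A :=
  Matrix.of fun i j => completeSum x ((a : ℤ) - (i : ℕ) + (j : ℕ))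

lemma sum_coeff_rootPoly_mul_completeSum_sub [IsDomain A] (x : Fin (m + 1) → A) (a : ℕ)
    (i : Fin (m + 1)) :
    ∑ j ∈ Finset.range (m + 2),
      (rootPoly x).coeff j * completeSum x ((a : ℤ) - (i : ℕ) + j) = 0 := by
  have h := sum_coeff_rootPoly_mul_completeSum x (a + (m + 1) - i)
  rw [if_neg (by omega), Fintype.card_fin] at h
  rw [← h]
  refine Finset.sum_congr rfl fun j _ => ?_
  congr 2
  omega

lemma jacobiTrudiMatrix_succ [IsDomain A] (x : Fin (m + 1) → A) (a : ℕ) :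
    jacobiTrudiMatrix x (a + 1) = jacobiTrudiMatrix x a * companionMatrix m (rootPoly x) := by
  ext i j
  rw [Matrix.mul_apply]
  refine Fin.lastCases ?_ (fun j => ?_) j
  · have h := sum_coeff_rootPoly_mul_completeSum_sub x a i
    have hc := coeff_rootPoly_card x
    rw [Fintype.card_fin] at hc
    rw [Finset.sum_range_succ, hc, Finset.sum_range] at h
    simp only [jacobiTrudiMatrix, companionMatrix, Matrix.of_apply, if_true, mul_neg,
      Finset.sum_neg_distrib, Fin.val_last]
    rw [eq_neg_iff_add_eq_zero, ← h, add_comm]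
    congr 1
    · exact Finset.sum_congr rfl fun _ _ => mul_comm _ _
    · rw [one_mul]
      congr 1
      push_cast
      ring
  · rw [Finset.sum_eq_single j.succ]
    · simp only [jacobiTrudiMatrix, companionMatrix, Matrix.of_apply, (Fin.castSucc_lt_last j).ne,
        if_false, Fin.val_succ, Fin.val_castSucc, if_true, mul_one]
      congr 1
      push_cast
      ring
    · intro l _ hl
      have : (l : ℕ) ≠ j + 1 := fun h => hl (Fin.ext (by simpa using h))
      simp [companionMatrix, (Fin.castSucc_lt_last j).ne, this]
    · simp

lemma det_jacobiTrudiMatrix [IsDomain A] (x : Fin (m + 1) → A) (a : ℕ) :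
    (jacobiTrudiMatrix x a).det = (∏ i, x i) ^ a := by
  induction a with
  | zero =>
    rw [pow_zero, Matrix.det_of_isUpperTriangular]
    · refine Finset.prod_eq_one fun i _ => ?_
      have h := sum_coeff_rootPoly_mul_completeSum x 0
      have hc := coeff_rootPoly_card x
      rw [Finset.sum_range_succ, Finset.sum_eq_zero, hc] at h
      · simpa [jacobiTrudiMatrix] using h
      · intro j hj
        rw [completeSum_of_neg, mul_zero]
        simp at hj ⊢
        omega
    · intro i j hij
      refine completeSum_of_neg x ?_
      have : (j : ℕ) < i := hij
      omega
  | succ a ih =>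
    rw [jacobiTrudiMatrix_succ, Matrix.det_mul, ih, det_companionMatrix, coeff_zero_rootPoly,
      Fintype.card_fin, ← mul_assoc ((-1) ^ (m + 1)), ← mul_pow, neg_one_mul, neg_neg, one_pow,
      one_mul, pow_succ]

/-- The vector which `jacobiTrudiMatrix x a` maps to a multiple of the last basis vector,
when `x i * y i = e` for all `i`. -/
def cornerVector (x y : Fin (m + 1) → A) (e : A) (a j : ℕ) : A :=
  ∑ r ∈ Finset.range (a + 1), (rootPoly x).coeff (j + 1 + r) * e ^ r *
    PowerSeries.coeff (a - r) (completeSeries y)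

lemma cornerVector_succ (x y : Fin (m + 1) → A) (e : A) (a j : ℕ) :
    cornerVector x y e (a + 1) j =
      (rootPoly x).coeff (j + 1) * PowerSeries.coeff (a + 1) (completeSeries y) +
        e * cornerVector x y e a (j + 1) := by
  rw [cornerVector, Finset.sum_range_succ', cornerVector, Finset.mul_sum, add_comm]
  congr 1
  · simp
  · refine Finset.sum_congr rfl fun r _ => ?_
    rw [Nat.add_sub_add_right, show j + 1 + (r + 1) = j + 1 + 1 + r by ring]
    ring

lemma cornerVector_eq_zero [Nontrivial A] (x y : Fin (m + 1) → A) (e : A) (a j : ℕ) (hj : m < j) :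
    cornerVector x y e a j = 0 := by
  refine Finset.sum_eq_zero fun r _ => ?_
  rw [Polynomial.coeff_eq_zero_of_natDegree_lt, zero_mul, zero_mul]
  rw [natDegree_rootPoly, Fintype.card_fin]
  omega

lemma cornerVector_last [Nontrivial A] (x y : Fin (m + 1) → A) (e : A) (a : ℕ) :
    cornerVector x y e a m = PowerSeries.coeff a (completeSeries y) := by
  have hc := coeff_rootPoly_card x
  rw [Fintype.card_fin] at hc
  cases a with
  | zero => simp [cornerVector, hc]
  | succ a => rw [cornerVector_succ, cornerVector_eq_zero x y e a _ (by omega), hc]; simp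

lemma coeff_zero_mul_add_mul_cornerVector (x y : Fin (m + 1) → A) (e : A)
    (hxy : ∀ i, x i * y i = e) (a : ℕ) :
    (rootPoly x).coeff 0 * PowerSeries.coeff (a + 1) (completeSeries y) +
      e * cornerVector x y e a 0 = 0 := by
  rw [← sum_coeff_rootPoly_mul_pow_mul_coeff x y e hxy a, Finset.sum_range_succ', cornerVector,
    Finset.mul_sum, add_comm]
  congr 1
  · refine Finset.sum_congr rfl fun r _ => ?_
    rw [Nat.add_sub_add_right, show 0 + 1 + r = r + 1 by ring]
    ring
  · simp

lemma jacobiTrudiMatrix_mulVec_cornerVector [IsDomain A] (x y : Fin (m + 1) → A) (e : A)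
    (hxy : ∀ i, x i * y i = e) (a : ℕ) :
    (jacobiTrudiMatrix x a).mulVec (fun j => cornerVector x y e a j) =
      e ^ a • Pi.single (Fin.last m) 1 := by
  ext i
  simp only [Matrix.mulVec, dotProduct, jacobiTrudiMatrix, Matrix.of_apply, Pi.smul_apply,
    smul_eq_mul]
  rw [Fin.sum_univ_eq_sum_range
    (fun j => completeSum x ((a : ℤ) - (i : ℕ) + (j : ℕ)) * cornerVector x y e a j)]
  induction a with
  | zero =>
    have h := sum_coeff_rootPoly_mul_completeSum x (m - i)
    rw [Fintype.card_fin, Finset.sum_range_succ', completeSum_of_neg, mul_zero, add_zero] at h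
    · have h0 : PowerSeries.coeff 0 (completeSeries y) = 1 := by
        simp [coeff_completeSeries, Finset.filter_true_of_mem]
      have hi : (m - (i : ℕ) = 0) ↔ i = Fin.last m := by
        rw [Fin.ext_iff, Fin.val_last]; omega
      rw [pow_zero, one_mul, Pi.single_apply, ← if_congr hi rfl rfl, ← h]
      refine Finset.sum_congr rfl fun j _ => ?_
      rw [mul_comm]
      congr 1
      · simp [cornerVector, h0]
      · congr 1
        push_cast
        omega
    · push_cast
      omega
  | succ a ih =>
    have h := sum_coeff_rootPoly_mul_completeSum_sub x a i
    have hz := coeff_zero_mul_add_mul_cornerVector x y e hxy a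
    have hs : ∑ j ∈ Finset.range (m + 1), completeSum x ((a : ℤ) - (i : ℕ) + ((j + 1 : ℕ) : ℤ)) *
        cornerVector x y e a (j + 1) = e ^ a * (Pi.single (Fin.last m) 1 : Fin (m + 1) → A) i -
          completeSum x ((a : ℤ) - (i : ℕ)) * cornerVector x y e a 0 := by
      rw [← ih, Finset.sum_range_succ, cornerVector_eq_zero x y e a (m + 1) (by omega),
        Finset.sum_range_succ' _ m]
      simp
    rw [Finset.sum_range_succ'] at h
    have hsplit : ∑ j ∈ Finset.range (m + 1), completeSum x (((a + 1 : ℕ) : ℤ) - (i : ℕ) + (j : ℕ)) *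
        cornerVector x y e (a + 1) j =
        PowerSeries.coeff (a + 1) (completeSeries y) * (∑ j ∈ Finset.range (m + 1),
          (rootPoly x).coeff (j + 1) * completeSum x ((a : ℤ) - (i : ℕ) + ((j + 1 : ℕ) : ℤ))) +
        e * ∑ j ∈ Finset.range (m + 1), completeSum x ((a : ℤ) - (i : ℕ) + ((j + 1 : ℕ) : ℤ)) *
          cornerVector x y e a (j + 1) := by
      rw [Finset.mul_sum, Finset.mul_sum, ← Finset.sum_add_distrib]
      refine Finset.sum_congr rfl fun j _ => ?_
      rw [cornerVector_succ, show ((a + 1 : ℕ) : ℤ) - (i : ℕ) + (j : ℕ) =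
        (a : ℤ) - (i : ℕ) + ((j + 1 : ℕ) : ℤ) by push_cast; ring]
      ring
    rw [hsplit, hs]
    simp only [Nat.cast_zero, add_zero] at h
    linear_combination PowerSeries.coeff (a + 1) (completeSeries y) * h -
      completeSum x ((a : ℤ) - (i : ℕ)) * hz

/-- The rectangular Jacobi–Trudi determinant in `x` is a complete homogeneous sum in the elements
`y i = ∏ j ≠ i, x j`. -/
lemma det_jacobiTrudi_eq_coeff [IsDomain A] (x y : Fin (m + 1) → A)
    (hx : ∏ i, x i ≠ 0) (hxy : ∀ i, x i * y i = ∏ j, x j) (a : ℕ) :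
    (Matrix.of fun i j : Fin m => completeSum x ((a : ℤ) - (i : ℕ) + (j : ℕ))).det =
      PowerSeries.coeff a (completeSeries y) := by
  have h := congrArg (fun v => (jacobiTrudiMatrix x a).adjugate.mulVec v (Fin.last m))
    (jacobiTrudiMatrix_mulVec_cornerVector x y _ hxy a)
  simp only [Matrix.mulVec_mulVec, Matrix.adjugate_mul, Matrix.mulVec_smul,
    Matrix.mulVec_single_one, Matrix.smul_mulVec, Matrix.one_mulVec, Pi.smul_apply, smul_eq_mul,
    Fin.val_last, cornerVector_last, det_jacobiTrudiMatrix, Matrix.col_apply] at h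
  rw [mul_left_cancel₀ (pow_ne_zero a hx) h, Matrix.adjugate_fin_succ_eq_det_submatrix,
    Even.neg_one_pow ⟨_, rfl⟩, one_mul]
  congr 1
  ext i j
  simp [jacobiTrudiMatrix]

end

lemma hpoly_eq_completeSum (k : ℕ) (m : ℤ) :
    hpoly k m = completeSum (fun i : Fin k => (MvPolynomial.X i : MvPolynomial (Fin k) ℤ)) m := by
  rw [hpoly, completeSum]
  split_ifs
  · rw [coeff_completeSeries]
  · rfl

/-- Complementing exponents turns a complete homogeneous sum in `y i = ∏ j ≠ i, x j` into a sum
of monomials in `x` with bounded exponents. -/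
lemma coeff_completeSeries_eq_sum_bounded {A : Type*} [CommRing A] [IsDomain A] {m : ℕ}
    (x y : Fin (m + 1) → A) (hx : ∏ i, x i ≠ 0) (hxy : ∀ i, x i * y i = ∏ j, x j) (a : ℕ) :
    PowerSeries.coeff a (completeSeries y) =
      ∑ μ ∈ (Finset.univ : Finset (Fin (m + 1) → Fin (a + 1))).filter
          (fun μ => ∑ i, (μ i : ℕ) = a * m), ∏ i, x i ^ (μ i : ℕ) := by
  rw [coeff_completeSeries]
  have hrev (μ : Fin (m + 1) → Fin (a + 1)) :
      ∑ i, (μ i : ℕ) + ∑ i, ((μ i).rev : ℕ) = a * m + a := by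
    rw [← Finset.sum_add_distrib, Finset.sum_congr rfl fun i _ =>
      show (μ i : ℕ) + ((μ i).rev : ℕ) = a by rw [Fin.val_rev]; omega]
    simp
    ring
  refine Finset.sum_nbij' (fun μ i => (μ i).rev) (fun μ i => (μ i).rev) ?_ ?_ ?_ ?_ ?_
  · intro μ hμ
    have := hrev μ
    simp only [Finset.mem_filter, Finset.mem_univ, true_and] at hμ ⊢
    omega
  · intro μ hμ
    have := hrev μ
    simp only [Finset.mem_filter, Finset.mem_univ, true_and] at hμ ⊢
    omega
  · intro μ _
    simp
  · intro μ _
    simp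
  · intro μ hμ
    have hsum : ∑ i, (μ i : ℕ) = a := by simpa using hμ
    have hne : ∏ i, x i ^ (μ i : ℕ) ≠ 0 :=
      Finset.prod_ne_zero_iff.2 fun i hi => pow_ne_zero _ (Finset.prod_ne_zero_iff.1 hx i hi)
    refine mul_left_cancel₀ hne ?_
    rw [← Finset.prod_mul_distrib, ← Finset.prod_mul_distrib]
    simp_rw [← mul_pow, ← pow_add, hxy]
    rw [Finset.prod_pow_eq_pow_sum, hsum, ← Finset.prod_pow]
    refine Finset.prod_congr rfl fun i _ => ?_
    congr 1
    rw [Fin.val_rev]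
    omega

/-- the Jacobi–Trudi determinant for the rectangular partition
`(n-k)^{k-1}` in `k` variables equals the sum of all monomials
`x_0^{μ_0} ⋯ x_{k-1}^{μ_{k-1}}` with `0 ≤ μ i ≤ n - k` and
`∑ μ i = (n - k) * (k - 1)`. -/
theorem stmt13 (n k : ℕ) (hk : 1 ≤ k) (hnk : k < n) :
    (Matrix.of fun i j : Fin (k - 1) =>
        hpoly k ((n : ℤ) - k - ((i : ℕ) : ℤ) + ((j : ℕ) : ℤ))).det =
      ∑ μ ∈ (Finset.univ : Finset (Fin k → Fin (n - k + 1))).filter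
          (fun μ => ∑ i, (μ i : ℕ) = (n - k) * (k - 1)),
        ∏ i, (MvPolynomial.X i : MvPolynomial (Fin k) ℤ) ^ (μ i : ℕ) := by
  obtain ⟨m, rfl⟩ : ∃ m, k = m + 1 := ⟨k - 1, by omega⟩
  generalize ha : n - (m + 1) = a
  let x : Fin (m + 1) → MvPolynomial (Fin (m + 1)) ℤ := fun i => MvPolynomial.X i
  have hx : ∏ i, x i ≠ 0 := Finset.prod_ne_zero_iff.2 fun i _ => MvPolynomial.X_ne_zero i
  have hxy (i) : x i * ∏ j ∈ Finset.univ.erase i, x j = ∏ j, x j :=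
    Finset.mul_prod_erase _ _ (Finset.mem_univ i)
  refine Eq.trans ?_ ((det_jacobiTrudi_eq_coeff x _ hx hxy a).trans
    (coeff_completeSeries_eq_sum_bounded x _ hx hxy a))
  congr 1
  ext1 i j
  simp only [Matrix.of_apply, hpoly_eq_completeSum]
  congr 1
  omega

end
end

section
/- Fix integers n > k ≥ 1 and K = k(n−k+1). Let D be a (K,k) Dyck path with big tuple b and small tuple s, and for 1 ≤ i ≤ k let h_i = 1 + Σ_{j<i}(s_j + b_j) − (i−1)(n−k+1) be the row of the lowest labeled box of column i in the shrunken diagram (column i shifted down by (n−k+1)(i−1)). Let μ = (μ^{(0)},…,μ^{(k−1)}) where μ^{(i)} is the single-column Young diagram with b_{k−i} boxes, and let c_i = i − k(h_{k−i} + s_{k−i}); for the box of μ^{(i)} in row r (rows of the column indexed 0,1,2,… from bottom), set its adjusted content to be c̃ = −k·r + c_i. Then there is a bijection between WPF(D,b) and the set of tuples T = (T_0,…,T_{k−1}) of strictly increasing fillings of the columns μ^{(0)},…,μ^{(k−1)} by positive integers (matching column i of D with μ^{(k−i)}), under which tdinv_big(π) equals the number of LLT inversion pairs of T, i.e., the number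 of pairs of boxes x ∈ μ^{(i)}, y ∈ μ^{(j)} with T(x) < T(y) and 0 < c̃(x) − c̃(y) < k. -/
open scoped Classical
open Finset

noncomputable section

/-- The small tuple: `sT t` is the number of small boxes in column `t`. -/
def sT (H b : ℕ → ℕ) (t : ℕ) : ℕ := H (t + 1) - H t - b t

/-- The bottom row of the labeled boxes of column `t` in the shrunken diagram
(1-indexed rows): `hrow t = 1 + Σ_{j<t} (s j + b j) - t * (n - k + 1)`. -/
def hrowZ (n k : ℕ) (H : ℕ → ℕ) (t : ℕ) : ℤ :=
  1 + (H t : ℤ) - (t : ℤ) * ((n : ℤ) - k + 1)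

/-- The shift `c_I = I - k * (h_{k-I} + s_{k-I})` attached to the `I`-th column
diagram `μ^{(I)}` (0-indexed: the paper's column `k - I` is column `k - 1 - I`). -/
def cshift (n k : ℕ) (H b : ℕ → ℕ) (I : ℕ) : ℤ :=
  (I : ℤ) - (k : ℤ) * (hrowZ n k H (k - 1 - I) + (sT H b (k - 1 - I) : ℤ))

/-- The adjusted content of the box of `μ^{(I)}` in row `r` (rows of the single
column indexed `0, 1, 2, …` from the bottom): `c̃ = -k * r + c_I`. -/
def adjC (n k : ℕ) (H b : ℕ → ℕ) (I r : ℕ) : ℤ :=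
  -(k : ℤ) * (r : ℤ) + cshift n k H b I

/-- The boxes of the tuple of single-column diagrams
`μ = (μ^{(0)}, …, μ^{(k-1)})`, where `μ^{(I)}` has `b (k-1-I)` boxes. -/
def tupleBoxes (k : ℕ) (b : ℕ → ℕ) : Finset (ℕ × ℕ) :=
  (range k).biUnion fun I => ({I} : Finset ℕ) ×ˢ range (b (k - 1 - I))

/-- An element of `WPF(D, b)`: a labeling of the big boxes by positive integers,
strictly increasing up each column, normalized to `0` off the big boxes. -/
def IsBigLab (K k : ℕ) (H b : ℕ → ℕ) (L : ℕ × ℕ → ℕ) : Prop :=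
  (∀ B ∈ bigBoxes K k H b, 1 ≤ L B) ∧
  (∀ i y, (i, y) ∈ bigBoxes K k H b → (i, y + 1) ∈ bigBoxes K k H b →
    L (i, y) < L (i, y + 1)) ∧
  ∀ B, B ∉ bigBoxes K k H b → L B = 0

/-- A tuple `T = (T_0, …, T_{k-1})` of strictly increasing fillings of the single
columns `μ^{(0)}, …, μ^{(k-1)}` by positive integers, normalized to `0` outside. -/
def IsColTuple (k : ℕ) (b : ℕ → ℕ) (T : ℕ × ℕ → ℕ) : Prop :=
  (∀ I r, I < k → r < b (k - 1 - I) → 1 ≤ T (I, r)) ∧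
  (∀ I r, I < k → r + 1 < b (k - 1 - I) → T (I, r) < T (I, r + 1)) ∧
  ∀ I r, ¬(I < k ∧ r < b (k - 1 - I)) → T (I, r) = 0

/-- The map matching column `i` of `D` (0-indexed) with `μ^{(k-1-i)}`: the `r`-th
box from the bottom of `μ^{(I)}` receives the label of the `r`-th big box from the
bottom of column `k-1-I` of `D`. -/
def toLLT (k : ℕ) (H b : ℕ → ℕ) (L : ℕ × ℕ → ℕ) : ℕ × ℕ → ℕ := fun p =>
  if p.1 < k ∧ p.2 < b (k - 1 - p.1) then
    L (k - 1 - p.1, H (k - 1 - p.1 + 1) - b (k - 1 - p.1) + p.2)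
  else 0

/-- The number of LLT inversion pairs of the tuple filling `T`: pairs of boxes
`x ∈ μ^{(I)}`, `y ∈ μ^{(J)}` with `T x < T y` and `0 < c̃ x - c̃ y < k`. -/
def LLTinvCount (n k : ℕ) (H b : ℕ → ℕ) (T : ℕ × ℕ → ℕ) : ℕ :=
  ((tupleBoxes k b ×ˢ tupleBoxes k b).filter fun p =>
    T p.1 < T p.2 ∧ 0 < adjC n k H b p.1.1 p.1.2 - adjC n k H b p.2.1 p.2.2 ∧
      adjC n k H b p.1.1 p.1.2 - adjC n k H b p.2.1 p.2.2 < (k : ℤ)).card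

/-- The big box matched with a box of the tuple of columns. -/
def toBigBox (k : ℕ) (H b : ℕ → ℕ) (p : ℕ × ℕ) : ℕ × ℕ :=
  (k - 1 - p.1, H (k - 1 - p.1 + 1) - b (k - 1 - p.1) + p.2)

/-- The box of the tuple of columns matched with a big box. -/
def ofBigBox (k : ℕ) (H b : ℕ → ℕ) (B : ℕ × ℕ) : ℕ × ℕ :=
  (k - 1 - B.1, B.2 - (H (B.1 + 1) - b B.1))

theorem mem_tupleBoxes {k : ℕ} {b : ℕ → ℕ} {p : ℕ × ℕ} :
    p ∈ tupleBoxes k b ↔ p.1 < k ∧ p.2 < b (k - 1 - p.1) := by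
  obtain ⟨I, r⟩ := p
  simp only [tupleBoxes, mem_biUnion, mem_product, mem_singleton, mem_range]
  constructor
  · rintro ⟨J, hJ, rfl, hr⟩
    exact ⟨hJ, hr⟩
  · rintro ⟨hI, hr⟩
    exact ⟨I, hI, rfl, hr⟩

theorem IsBigTuple.le_height {n k K : ℕ} {H b : ℕ → ℕ} (hD : IsDyck K k H)
    (hb : IsBigTuple n k H b) {t : ℕ} (ht : t < k) :
    H t + b t ≤ H (t + 1) := by
  have h1 := hb.1 t ht
  have h2 := hD.2.1 (Nat.le_succ t)
  simp only [Nat.succ_eq_add_one] at h2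
  omega

theorem mem_bigBoxes {n k K : ℕ} {H b : ℕ → ℕ} (hD : IsDyck K k H)
    (hb : IsBigTuple n k H b) {B : ℕ × ℕ} :
    B ∈ bigBoxes K k H b ↔ B.1 < k ∧ H (B.1 + 1) - b B.1 ≤ B.2 ∧ B.2 < H (B.1 + 1) := by
  obtain ⟨t, y⟩ := B
  simp only [bigBoxes, mem_filter, mem_product, mem_range]
  constructor
  · rintro ⟨⟨ht, -⟩, -, h1, h2⟩
    exact ⟨ht, h1, h2⟩
  · rintro ⟨ht, h1, h2⟩
    have hle := hb.le_height hD ht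
    have hK : H (t + 1) ≤ K := (hD.2.1 (Nat.succ_le_of_lt ht)).trans (hD.2.2.1 k le_rfl).le
    exact ⟨⟨ht, by omega⟩, by omega, h1, h2⟩

theorem toBigBox_mem {n k K : ℕ} {H b : ℕ → ℕ} (hD : IsDyck K k H)
    (hb : IsBigTuple n k H b) {p : ℕ × ℕ} (hp : p ∈ tupleBoxes k b) :
    toBigBox k H b p ∈ bigBoxes K k H b := by
  rw [mem_tupleBoxes] at hp
  have ht : k - 1 - p.1 < k := by omega
  have hle := hb.le_height hD ht
  rw [mem_bigBoxes hD hb]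
  simp only [toBigBox]
  omega

theorem ofBigBox_mem {n k K : ℕ} {H b : ℕ → ℕ} (hD : IsDyck K k H)
    (hb : IsBigTuple n k H b) {B : ℕ × ℕ} (hB : B ∈ bigBoxes K k H b) :
    ofBigBox k H b B ∈ tupleBoxes k b := by
  rw [mem_bigBoxes hD hb] at hB
  have hle := hb.le_height hD hB.1
  have ht : k - 1 - (k - 1 - B.1) = B.1 := by omega
  rw [mem_tupleBoxes]
  simp only [ofBigBox, ht]
  omega

theorem ofBigBox_toBigBox {k : ℕ} {H b : ℕ → ℕ} {p : ℕ × ℕ} (hp : p ∈ tupleBoxes k b) :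
    ofBigBox k H b (toBigBox k H b p) = p := by
  rw [mem_tupleBoxes] at hp
  ext <;> simp only [ofBigBox, toBigBox] <;> omega

theorem toBigBox_ofBigBox {n k K : ℕ} {H b : ℕ → ℕ} (hD : IsDyck K k H)
    (hb : IsBigTuple n k H b) {B : ℕ × ℕ} (hB : B ∈ bigBoxes K k H b) :
    toBigBox k H b (ofBigBox k H b B) = B := by
  rw [mem_bigBoxes hD hb] at hB
  have ht : k - 1 - (k - 1 - B.1) = B.1 := by omega
  ext <;> simp only [ofBigBox, toBigBox, ht]
  omega

theorem toLLT_of_mem {k : ℕ} {H b : ℕ → ℕ} (L : ℕ × ℕ → ℕ) {p : ℕ × ℕ}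
    (hp : p ∈ tupleBoxes k b) : toLLT k H b L p = L (toBigBox k H b p) :=
  if_pos (mem_tupleBoxes.1 hp)

theorem toLLT_of_notMem {k : ℕ} {H b : ℕ → ℕ} (L : ℕ × ℕ → ℕ) {p : ℕ × ℕ}
    (hp : p ∉ tupleBoxes k b) : toLLT k H b L p = 0 :=
  if_neg (mt mem_tupleBoxes.2 hp)

theorem bijOn_toLLT {n k K : ℕ} {H b : ℕ → ℕ} (hD : IsDyck K k H)
    (hb : IsBigTuple n k H b) :
    Set.BijOn (toLLT k H b) {L | IsBigLab K k H b L} {T | IsColTuple k b T} := by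
  refine ⟨?_, ?_, ?_⟩
  · rintro L ⟨hpos, hinc, -⟩
    refine ⟨fun I r hI hr => ?_, fun I r hI hr => ?_, fun I r h => ?_⟩
    · have hp : (I, r) ∈ tupleBoxes k b := mem_tupleBoxes.2 ⟨hI, hr⟩
      rw [toLLT_of_mem L hp]
      exact hpos _ (toBigBox_mem hD hb hp)
    · have hp : (I, r) ∈ tupleBoxes k b := mem_tupleBoxes.2 ⟨hI, (Nat.lt_succ_self r).trans hr⟩
      have hq : (I, r + 1) ∈ tupleBoxes k b := mem_tupleBoxes.2 ⟨hI, hr⟩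
      rw [toLLT_of_mem L hp, toLLT_of_mem L hq]
      exact hinc _ _ (toBigBox_mem hD hb hp) (toBigBox_mem hD hb hq)
    · exact toLLT_of_notMem L (mt mem_tupleBoxes.1 h)
  · intro L hL L' hL' h
    funext B
    by_cases hB : B ∈ bigBoxes K k H b
    · have hq := ofBigBox_mem hD hb hB
      have := congrFun h (ofBigBox k H b B)
      rwa [toLLT_of_mem L hq, toLLT_of_mem L' hq, toBigBox_ofBigBox hD hb hB] at this
    · rw [hL.2.2 B hB, hL'.2.2 B hB]
  · rintro T ⟨hpos, hinc, hzero⟩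
    refine ⟨fun B => if B ∈ bigBoxes K k H b then T (ofBigBox k H b B) else 0,
      ⟨fun B hB => ?_, fun i y hB hB' => ?_, fun B hB => if_neg hB⟩, ?_⟩
    · have hq := mem_tupleBoxes.1 (ofBigBox_mem hD hb hB)
      beta_reduce
      rw [if_pos hB]
      exact hpos _ _ hq.1 hq.2
    · beta_reduce
      rw [if_pos hB, if_pos hB']
      have hq := mem_tupleBoxes.1 (ofBigBox_mem hD hb hB')
      have hy : y + 1 - (H (i + 1) - b i) = y - (H (i + 1) - b i) + 1 :=
        Nat.succ_sub ((mem_bigBoxes hD hb).1 hB).2.1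
      simp only [ofBigBox, hy] at hq ⊢
      exact hinc _ _ hq.1 hq.2
    · funext p
      by_cases hp : p ∈ tupleBoxes k b
      · rw [toLLT_of_mem _ hp, if_pos (toBigBox_mem hD hb hp), ofBigBox_toBigBox hp]
      · rw [toLLT_of_notMem _ hp]
        exact (hzero p.1 p.2 (mt mem_tupleBoxes.2 hp)).symm

/-- The adjusted content of a box is determined by the diagonal and the column of the
matched big box. -/
theorem adjC_eq {n k K : ℕ} {H b : ℕ → ℕ} (hnk : k < n) (hD : IsDyck K k H)
    (hb : IsBigTuple n k H b) {p : ℕ × ℕ} (hp : p ∈ tupleBoxes k b) :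
    adjC n k H b p.1 p.2 = (k : ℤ) - 1 - (toBigBox k H b p).1 -
      k * (1 + diagIdx (n - k + 1) (toBigBox k H b p)) := by
  obtain ⟨I, r⟩ := p
  rw [mem_tupleBoxes] at hp
  have hI : (I : ℤ) = (k : ℤ) - 1 - ((k - 1 - I : ℕ) : ℤ) := by omega
  have hle := hb.le_height hD (show k - 1 - I < k by omega)
  have hc : ((n - k + 1 : ℕ) : ℤ) = (n : ℤ) - k + 1 := by omega
  simp only [adjC, cshift, hrowZ, sT, diagIdx, toBigBox, hc]
  generalize k - 1 - I = t at *
  have hs : ((H (t + 1) - H t - b t : ℕ) : ℤ) = H (t + 1) - H t - b t := by omega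
  have hy : ((H (t + 1) - b t + r : ℕ) : ℤ) = H (t + 1) - b t + r := by omega
  rw [hs, hy, hI]
  ring

/-- Boxes in `k` columns attack each other exactly when the corresponding adjusted contents
differ by an amount strictly between `0` and `k`. -/
theorem attack_iff {k c : ℕ} {A B : ℕ × ℕ} (hA : A.1 < k) (hB : B.1 < k) :
    Attack c A B ↔
      0 < ((k : ℤ) - 1 - A.1 - k * (1 + diagIdx c A)) -
          ((k : ℤ) - 1 - B.1 - k * (1 + diagIdx c B)) ∧
        ((k : ℤ) - 1 - A.1 - k * (1 + diagIdx c A)) -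
          ((k : ℤ) - 1 - B.1 - k * (1 + diagIdx c B)) < k := by
  have hA' : (A.1 : ℤ) < k := by exact_mod_cast hA
  have hB' : (B.1 : ℤ) < k := by exact_mod_cast hB
  unfold Attack
  generalize diagIdx c A = d
  generalize diagIdx c B = e
  constructor
  · rintro (⟨rfl, h⟩ | ⟨rfl, h⟩)
    · constructor <;> linarith
    · constructor <;> linarith
  · rintro ⟨h1, h2⟩
    have hde : d < e + 1 := by
      by_contra! h
      nlinarith
    have hed : e < d + 2 := by
      by_contra! h
      nlinarith
    obtain rfl | rfl : d = e ∨ d = e - 1 := by omega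
    · left
      refine ⟨rfl, ?_⟩
      linarith
    · right
      refine ⟨rfl, ?_⟩
      linarith

theorem tdinvOn_bigBoxes_eq_LLTinvCount {n k K : ℕ} {H b : ℕ → ℕ} (hnk : k < n)
    (hD : IsDyck K k H) (hb : IsBigTuple n k H b) (L : ℕ × ℕ → ℕ) :
    tdinvOn (n - k + 1) (bigBoxes K k H b) L = LLTinvCount n k H b (toLLT k H b L) := by
  have key : ∀ p ∈ tupleBoxes k b, ∀ q ∈ tupleBoxes k b,
      (Attack (n - k + 1) (toBigBox k H b p) (toBigBox k H b q) ∧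
        L (toBigBox k H b p) < L (toBigBox k H b q)) ↔
      (toLLT k H b L p < toLLT k H b L q ∧
        0 < adjC n k H b p.1 p.2 - adjC n k H b q.1 q.2 ∧
        adjC n k H b p.1 p.2 - adjC n k H b q.1 q.2 < (k : ℤ)) := by
    intro p hp q hq
    rw [toLLT_of_mem L hp, toLLT_of_mem L hq, adjC_eq hnk hD hb hp, adjC_eq hnk hD hb hq,
      ← attack_iff ((mem_bigBoxes hD hb).1 (toBigBox_mem hD hb hp)).1
        ((mem_bigBoxes hD hb).1 (toBigBox_mem hD hb hq)).1, and_comm]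
  symm
  refine Finset.card_nbij' (Prod.map (toBigBox k H b) (toBigBox k H b))
    (Prod.map (ofBigBox k H b) (ofBigBox k H b)) ?_ ?_ ?_ ?_
  · rintro ⟨p, q⟩ h
    simp only [coe_filter, mem_product, Set.mem_ofPred_eq] at h
    simp only [coe_filter, mem_product, Set.mem_ofPred_eq, Prod.map]
    exact ⟨⟨toBigBox_mem hD hb h.1.1, toBigBox_mem hD hb h.1.2⟩,
      (key p h.1.1 q h.1.2).2 h.2⟩
  · rintro ⟨A, B⟩ h
    simp only [coe_filter, mem_product, Set.mem_ofPred_eq] at h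
    simp only [coe_filter, mem_product, Set.mem_ofPred_eq, Prod.map]
    have hA := ofBigBox_mem hD hb h.1.1
    have hB := ofBigBox_mem hD hb h.1.2
    refine ⟨⟨hA, hB⟩, (key _ hA _ hB).1 ?_⟩
    rw [toBigBox_ofBigBox hD hb h.1.1, toBigBox_ofBigBox hD hb h.1.2]
    exact h.2
  · rintro ⟨p, q⟩ h
    simp only [coe_filter, mem_product, Set.mem_ofPred_eq] at h
    simp only [Prod.map, ofBigBox_toBigBox h.1.1, ofBigBox_toBigBox h.1.2]
  · rintro ⟨A, B⟩ h
    simp only [coe_filter, mem_product, Set.mem_ofPred_eq] at h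
    simp only [Prod.map, toBigBox_ofBigBox hD hb h.1.1, toBigBox_ofBigBox hD hb h.1.2]

/-- `toLLT` is a bijection between `WPF(D, b)` and the set of tuples
of strictly increasing fillings of the single-column diagrams
`μ = (1^{b_k}, …, 1^{b_1})`, under which `tdinv_big π` equals the number of LLT
inversion pairs. -/
theorem stmt16 (n k : ℕ) (hk : 1 ≤ k) (hnk : k < n) (H b : ℕ → ℕ)
    (hD : IsDyck (k * (n - k + 1)) k H) (hb : IsBigTuple n k H b) :
    Set.BijOn (toLLT k H b)
        {L : ℕ × ℕ → ℕ | IsBigLab (k * (n - k + 1)) k H b L}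
        {T : ℕ × ℕ → ℕ | IsColTuple k b T} ∧
      ∀ L : ℕ × ℕ → ℕ, IsBigLab (k * (n - k + 1)) k H b L →
        tdinvOn (n - k + 1) (bigBoxes (k * (n - k + 1)) k H b) L =
          LLTinvCount n k H b (toLLT k H b L) :=
  ⟨bijOn_toLLT hD hb, fun L _ => tdinvOn_bigBoxes_eq_LLTinvCount hnk hD hb L⟩

end
end

section
/- For positive integers K,k with k dividing K and any (K,k) Dyck path D, the maximum of tdinv over all word parking functions of shape D equals the number of attacking ordered pairs of labeled boxes of D; moreover this maximum is attained by the labeling that assigns distinct labels to the labeled boxes in increasing order along diagonals, proceeding through the diagonals from bottom to top and left to right within each diagonal. -/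
open scoped Classical
open Finset

noncomputable section

/-- The labeling of the boxes of the path which assigns distinct labels in
increasing order along diagonals, proceeding through the diagonals from bottom to
top, and from left to right within each diagonal. -/
def diagOrderLab (c K k : ℕ) (H : ℕ → ℕ) : ℕ × ℕ → ℕ := fun B =>
  1 + ((boxesD K k H).filter fun A =>
    diagIdx c A < diagIdx c B ∨ (diagIdx c A = diagIdx c B ∧ A.1 < B.1)).card

theorem tdinvOn_le (c : ℕ) (S : Finset (ℕ × ℕ)) (L : ℕ × ℕ → ℕ) :
    tdinvOn c S L ≤ (attackPairsOn c S).card :=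
  card_le_card <| monotone_filter_right _ fun _ _ h => h.1

/-- `diagOrderLab` is strictly increasing for the order it reads the boxes in. -/
theorem diagOrderLab_lt {c K k : ℕ} {H : ℕ → ℕ} {A B : ℕ × ℕ} (hA : A ∈ boxesD K k H)
    (h : diagIdx c A < diagIdx c B ∨ (diagIdx c A = diagIdx c B ∧ A.1 < B.1)) :
    diagOrderLab c K k H A < diagOrderLab c K k H B := by
  refine Nat.add_lt_add_left (card_lt_card ?_) 1
  refine (ssubset_iff_of_subset ?_).2 ⟨A, by simp [hA, h], by simp⟩
  refine monotone_filter_right _ fun C _ hC => ?_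
  omega

theorem tdinvOn_diagOrderLab (c K k : ℕ) (H : ℕ → ℕ) :
    tdinvOn c (boxesD K k H) (diagOrderLab c K k H) =
      (attackPairsOn c (boxesD K k H)).card := by
  refine congrArg card (filter_congr fun p hp => and_iff_left_of_imp fun h => ?_)
  refine diagOrderLab_lt (mem_product.1 hp).1 ?_
  unfold Attack at h
  omega

theorem isWordPF_diagOrderLab (c : ℕ) {K k : ℕ} {H : ℕ → ℕ} (hD : IsDyck K k H) :
    IsWordPF K k H (diagOrderLab c K k H) := by
  obtain ⟨-, hmono, htop, -⟩ := hD
  refine ⟨fun B _ => Nat.le_add_right 1 _, fun i y hi hy hy' => diagOrderLab_lt ?_ (Or.inl ?_)⟩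
  · have hK : H (i + 1) ≤ K := (hmono (show i + 1 ≤ k from hi)).trans_eq (htop k le_rfl)
    simp only [boxesD, mem_filter, mem_product, mem_range]
    omega
  · simp [diagIdx]

/-- the maximum of `tdinv` over all word parking functions of shape
`D` equals the number of attacking ordered pairs of labeled boxes of `D`, and this
maximum is attained by the labeling `diagOrderLab` that assigns distinct labels to
the labeled boxes in increasing order along diagonals, from bottom to top and from
left to right within each diagonal. -/
theorem stmt18 (K k : ℕ) (hk : 1 ≤ k) (hdvd : k ∣ K) (H : ℕ → ℕ)
    (hD : IsDyck K k H) :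
    maxtdinvD (K / k) K k H = (attackPairsOn (K / k) (boxesD K k H)).card ∧
    IsWordPF K k H (diagOrderLab (K / k) K k H) ∧
    tdinvOn (K / k) (boxesD K k H) (diagOrderLab (K / k) K k H) =
      (attackPairsOn (K / k) (boxesD K k H)).card := by
  have hlab := isWordPF_diagOrderLab (K / k) hD
  have hcard := tdinvOn_diagOrderLab (K / k) K k H
  refine ⟨IsGreatest.csSup_eq ⟨⟨_, hlab, hcard⟩, ?_⟩, hlab, hcard⟩
  rintro _ ⟨L, -, rfl⟩
  exact tdinvOn_le _ _ _

end
end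

section
/- Fix integers n > k ≥ 1. Let P be a complete shrunken diagram with parameters (n,k) and let (x,y) be an attacking pair of entries of its complement, i.e., x is in the same row as y and strictly to its left, or x is in the row directly below y and strictly to its right. Then y precedes x in the reading word of the complement. Consequently, every attacking pair of complement entries with value(x) ≤ value(y) yields a tied inversion of the reading word (an earlier letter that is greater than or equal to a later letter), and distinct attacking pairs yield distinct pairs of positions in the reading word. -/
open scoped Classical

noncomputable section

/-- Raw data of a diagram with `k` columns: each column `i` has labeled boxes in the
rows `h i, h i + 1, …, h' i` (rows indexed by integers, increasing upward), and
`lab i r` is the label of the box of column `i` in row `r`. -/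
structure SDiag (k : ℕ) where
  h : Fin k → ℤ
  h' : Fin k → ℤ
  lab : Fin k → ℤ → ℕ

/-- A *complete shrunken diagram* with parameters `(n, k)` (with `N = n - k`):
labels lie in `{0, 1, …, N}` and weakly increase up each column, only the label `0`
may repeat within a column, `h' i ≥ N + 1`, `h 0 = 1`, `h' (k-1) = N + 1`, and
`h (i+1) = h' i - N`. -/
def IsCompleteSD (n k : ℕ) (P : SDiag k) : Prop :=
  (∀ i, P.h i ≤ P.h' i) ∧
  (∀ i, ((n : ℤ) - k) + 1 ≤ P.h' i) ∧
  (∀ h0 : 0 < k, P.h ⟨0, h0⟩ = 1) ∧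
  (∀ h0 : 0 < k, P.h' ⟨k - 1, Nat.sub_lt h0 Nat.one_pos⟩ = ((n : ℤ) - k) + 1) ∧
  (∀ (i : Fin k) (hi : (i : ℕ) + 1 < k), P.h ⟨(i : ℕ) + 1, hi⟩ = P.h' i - ((n : ℤ) - k)) ∧
  (∀ i r, P.h i ≤ r → r ≤ P.h' i → P.lab i r ≤ n - k) ∧
  ∀ i r r', P.h i ≤ r → r < r' → r' ≤ P.h' i →
    P.lab i r < P.lab i r' ∨ (P.lab i r = 0 ∧ P.lab i r' = 0)

/-- Row `r` of column `i` holds a labeled box. -/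
def occS {k : ℕ} (P : SDiag k) (i : Fin k) (r : ℤ) : Prop := P.h i ≤ r ∧ r ≤ P.h' i

/-- `maxInvS P`: the number of attacking pairs `(x, y)` of labeled boxes, i.e. `x` in
the same row as `y` and strictly to its left, or `x` in the row directly below `y`
and strictly to its right. -/
def maxInvS {k : ℕ} (P : SDiag k) : ℕ :=
  ∑ i : Fin k, ∑ j : Fin k,
    ((Finset.Icc (P.h i) (P.h' i)).filter fun r =>
      (i < j ∧ occS P j r) ∨ (j < i ∧ occS P j (r + 1))).card

/-- `InvS P`: the number of attacking pairs `(x, y)` of labeled boxes with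
`label x < label y`. -/
def InvS {k : ℕ} (P : SDiag k) : ℕ :=
  ∑ i : Fin k, ∑ j : Fin k,
    ((Finset.Icc (P.h i) (P.h' i)).filter fun r =>
      (i < j ∧ occS P j r ∧ P.lab i r < P.lab j r) ∨
      (j < i ∧ occS P j (r + 1) ∧ P.lab i r < P.lab j (r + 1))).card

/-- `pathdinvS n k P`: the number of ordered pairs of boxes `(x, y)` in the same
row with `x` strictly to the left of `y`, `y` a labeled box, and `x` (labeled or
not) at most `n - k + 1` rows below the topmost labeled box of its column. -/
def pathdinvS (n k : ℕ) (P : SDiag k) : ℕ :=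
  ∑ i : Fin k, ∑ j : Fin k,
    if i < j then
      ((Finset.Icc (P.h j) (P.h' j)).filter fun r =>
        P.h' i - ((n : ℤ) - k + 1) ≤ r).card
    else 0

/-- The number of nonzero labels of column `i`. -/
def bS {k : ℕ} (P : SDiag k) (i : Fin k) : ℕ :=
  ((Finset.Icc (P.h i) (P.h' i)).filter fun r => P.lab i r ≠ 0).card

/-- The complement of column `i`: the elements of `{1, …, n-k}` not occurring as
labels of column `i`. -/
def compSetS (n k : ℕ) (P : SDiag k) (i : Fin k) : Finset ℕ :=
  (Finset.Icc 1 (n - k)).filter fun v => ∀ r, P.h i ≤ r → r ≤ P.h' i → P.lab i r ≠ v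

/-- The row of the complement entry `v` of column `i`: the complement entries are
written in increasing order from top to bottom in the rows
`h' i - bS i, h' i - bS i - 1, …`. -/
def compRowS (n k : ℕ) (P : SDiag k) (i : Fin k) (v : ℕ) : ℤ :=
  P.h' i - bS P i - ((compSetS n k P i).filter fun u => u < v).card

/-- A *generalized shrunken fixed point*: a complete shrunken diagram whose
complement reading word (row by row from top to bottom, right to left within each
row) is strictly increasing. -/
def IsGSFP (n k : ℕ) (P : SDiag k) : Prop :=
  IsCompleteSD n k P ∧
  ∀ (i i' : Fin k) (v v' : ℕ), v ∈ compSetS n k P i → v' ∈ compSetS n k P i' →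
    (compRowS n k P i' v' < compRowS n k P i v ∨
      (compRowS n k P i v = compRowS n k P i' v' ∧ i' < i)) →
    v < v'

/-- Column `i` is *basic*: it occupies rows `1` through `n - k + 1` with labels
`0, 1, …, n - k` from bottom to top. -/
def IsBasicCol (n k : ℕ) (P : SDiag k) (i : Fin k) : Prop :=
  P.h i = 1 ∧ P.h' i = (n : ℤ) - k + 1 ∧
  ∀ r : ℤ, 1 ≤ r → r ≤ (n : ℤ) - k + 1 → P.lab i r = (r - 1).toNat

/-- The entries of the complement of `P`: pairs `(i, v)` with `v` an element of the
complement of column `i`. -/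
def EntS (n k : ℕ) (P : SDiag k) : Finset (Fin k × ℕ) :=
  ((Finset.univ : Finset (Fin k)) ×ˢ Finset.Icc 1 (n - k)).filter fun e =>
    e.2 ∈ compSetS n k P e.1

/-- `e` precedes `f` in the reading word of the complement (row by row from top to
bottom, right to left within each row). -/
def PrecedeS (n k : ℕ) (P : SDiag k) (e f : Fin k × ℕ) : Prop :=
  compRowS n k P f.1 f.2 < compRowS n k P e.1 e.2 ∨
    (compRowS n k P e.1 e.2 = compRowS n k P f.1 f.2 ∧ f.1 < e.1)

/-- `(x, y)` is an attacking pair of complement entries: `x` in the same row as `y`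
and strictly to its left, or `x` in the row directly below `y` and strictly to its
right. -/
def AttackCompS (n k : ℕ) (P : SDiag k) (x y : Fin k × ℕ) : Prop :=
  (compRowS n k P x.1 x.2 = compRowS n k P y.1 y.2 ∧ x.1 < y.1) ∨
    (compRowS n k P x.1 x.2 + 1 = compRowS n k P y.1 y.2 ∧ y.1 < x.1)

/-- The position of a complement entry in the reading word: the number of entries
strictly preceding it. -/
def posS (n k : ℕ) (P : SDiag k) (e : Fin k × ℕ) : ℕ :=
  ((EntS n k P).filter fun f => PrecedeS n k P f e).card

theorem AttackCompS.precedeS {n k : ℕ} {P : SDiag k} {x y : Fin k × ℕ}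
    (h : AttackCompS n k P x y) : PrecedeS n k P y x := by
  rcases h with ⟨h, hlt⟩ | ⟨h, -⟩
  · exact Or.inr ⟨h.symm, hlt⟩
  · exact Or.inl (by omega)

theorem PrecedeS.irrefl {n k : ℕ} {P : SDiag k} (e : Fin k × ℕ) : ¬ PrecedeS n k P e e := by
  rintro (h | ⟨-, h⟩) <;> exact lt_irrefl _ h

theorem PrecedeS.trans {n k : ℕ} {P : SDiag k} {e f g : Fin k × ℕ}
    (hef : PrecedeS n k P e f) (hfg : PrecedeS n k P f g) : PrecedeS n k P e g := by
  rcases hef with h | ⟨h, hlt⟩ <;> rcases hfg with h' | ⟨h', hlt'⟩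
  · exact Or.inl (by omega)
  · exact Or.inl (by omega)
  · exact Or.inl (by omega)
  · exact Or.inr ⟨h.trans h', hlt'.trans hlt⟩

theorem mem_compSetS_of_mem_EntS {n k : ℕ} {P : SDiag k} {e : Fin k × ℕ}
    (he : e ∈ EntS n k P) : e.2 ∈ compSetS n k P e.1 :=
  (Finset.mem_filter.mp he).2

/-- Complement entries of a column sit strictly lower as they grow. -/
theorem compRowS_lt_of_lt {n k : ℕ} {P : SDiag k} {i : Fin k} {v w : ℕ}
    (hv : v ∈ compSetS n k P i) (hvw : v < w) : compRowS n k P i w < compRowS n k P i v := by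
  have hcard : ((compSetS n k P i).filter fun u => u < v).card <
      ((compSetS n k P i).filter fun u => u < w).card := by
    refine Finset.card_lt_card (Finset.ssubset_iff_of_subset ?_ |>.mpr ⟨v, ?_, ?_⟩)
    · exact Finset.monotone_filter_right _ fun u _ hu => hu.trans hvw
    · exact Finset.mem_filter.mpr ⟨hv, hvw⟩
    · simp
  unfold compRowS
  omega

theorem PrecedeS.total {n k : ℕ} {P : SDiag k} {e f : Fin k × ℕ}
    (he : e ∈ EntS n k P) (hf : f ∈ EntS n k P) (hne : e ≠ f) :
    PrecedeS n k P e f ∨ PrecedeS n k P f e := by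
  rcases lt_trichotomy (compRowS n k P e.1 e.2) (compRowS n k P f.1 f.2) with h | h | h
  · exact Or.inr (Or.inl h)
  · rcases lt_trichotomy e.1 f.1 with hc | hc | hc
    · exact Or.inr (Or.inr ⟨h.symm, hc⟩)
    · have he' := mem_compSetS_of_mem_EntS he
      have hf' := mem_compSetS_of_mem_EntS hf
      rw [hc] at h he'
      rcases lt_trichotomy e.2 f.2 with hv | hv | hv
      · exact absurd h (compRowS_lt_of_lt he' hv).ne'
      · exact absurd (Prod.ext hc hv) hne
      · exact absurd h (compRowS_lt_of_lt hf' hv).ne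
    · exact Or.inl (Or.inr ⟨h, hc⟩)
  · exact Or.inl (Or.inl h)

theorem PrecedeS.posS_lt {n k : ℕ} {P : SDiag k} {e f : Fin k × ℕ}
    (he : e ∈ EntS n k P) (h : PrecedeS n k P e f) : posS n k P e < posS n k P f := by
  refine Finset.card_lt_card (Finset.ssubset_iff_of_subset ?_ |>.mpr ⟨e, ?_, ?_⟩)
  · exact Finset.monotone_filter_right _ fun g _ hg => PrecedeS.trans hg h
  · exact Finset.mem_filter.mpr ⟨he, h⟩
  · exact fun hmem => PrecedeS.irrefl e (Finset.mem_filter.mp hmem).2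

/-- in a complete shrunken diagram, for every attacking pair `(x, y)`
of complement entries, `y` precedes `x` in the reading word of the complement.
Consequently every attacking pair with `value x ≤ value y` yields a tied inversion
of the reading word (the position of `y` comes strictly before that of `x`), and
distinct attacking pairs yield distinct pairs of positions (the position map is
injective on complement entries). -/
theorem stmt19 (n k : ℕ) (hk : 1 ≤ k) (hnk : k < n) (P : SDiag k)
    (hP : IsCompleteSD n k P) :
    (∀ x ∈ EntS n k P, ∀ y ∈ EntS n k P, AttackCompS n k P x y → PrecedeS n k P y x) ∧
    (∀ x ∈ EntS n k P, ∀ y ∈ EntS n k P, AttackCompS n k P x y → x.2 ≤ y.2 →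
      posS n k P y < posS n k P x) ∧
    Set.InjOn (posS n k P) ↑(EntS n k P) := by
  refine ⟨fun x _ y _ h => h.precedeS, fun x _ y hy h _ => h.precedeS.posS_lt hy, ?_⟩
  intro x hx y hy hxy
  by_contra hne
  rcases PrecedeS.total hx hy hne with h | h
  · exact (h.posS_lt hx).ne hxy
  · exact (h.posS_lt hy).ne' hxy

end
end
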